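/- Let g ≥ 0, n ≥ 1, and let a, b ≥ 0 be integers. For every integer k ≥ 2g−3+a+b, the coefficient of y^k times any monomial in the variables z_1,…,z_a, w_1,…,w_b, x_1,…,x_n in L_g(y; z_1,…,z_a; w_1,…,w_b; x_1,…,x_n) vanishes. -/

import Mathlib

open MvPolynomial Finset

noncomputable section

/-- The polynomial ring `ℚ[x_1,…,x_n]`. -/
abbrev R (n : ℕ) : Type := MvPolynomial (Fin n) ℚ

/-- The field of rational functions `ℚ(x_1,…,x_n)`. -/
abbrev K (n : ℕ) : Type := FractionRing (R n)

/-- `x_1 + ⋯ + x_n` as an element of `K n`. -/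
def SX (n : ℕ) : K n := algebraMap (R n) (K n) (∑ j, X j)

/-- `x_1^3 + ⋯ + x_n^3` as an element of `K n`. -/
def SX3 (n : ℕ) : K n := algebraMap (R n) (K n) (∑ j, (X j)^3)

/-- `Δ(x_1,…,x_n) = ((Σ x_j)^3 − Σ x_j^3)/3`. -/
def Dlt (n : ℕ) : K n := ((SX n)^3 - SX3 n) / 3

/-- The ring homomorphism `ℚ[x_1,…,x_{|I|}] → ℚ(x_1,…,x_n)` substituting the variables
of the subset `I` (in increasing order). -/
def embRH {n : ℕ} (I : Finset (Fin n)) : R I.card →+* K n :=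
  (algebraMap (R n) (K n)).comp
    (MvPolynomial.rename (fun i : Fin I.card => ((I.orderIsoOfFin rfl) i : Fin n))).toRingHom

lemma embRH_inj {n : ℕ} (I : Finset (Fin n)) : Function.Injective (embRH I) := by
  have h1 : Function.Injective (fun i : Fin I.card => ((I.orderIsoOfFin rfl) i : Fin n)) := by
    intro i j hij
    exact (I.orderIsoOfFin rfl).injective (Subtype.val_injective hij)
  have h2 := (IsFractionRing.injective (R n) (K n)).comp (MvPolynomial.rename_injective _ h1)
  simpa [embRH, RingHom.coe_comp] using h2

/-- The field embedding `ℚ(x_1,…,x_{|I|}) → ℚ(x_1,…,x_n)` substituting the variables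
of the subset `I` (in increasing order).  Used for expressions like `G_{r'}(x_I)`. -/
def emb {n : ℕ} (I : Finset (Fin n)) : K I.card →+* K n :=
  IsFractionRing.lift (embRH_inj I)

/-- The normalized `n`-point functions `G_g(x_1,…,x_n)`, defined with a fuel parameter
(first argument) for structural recursion; for `fuel ≥ n` this computes the recursively
defined normalized `n`-point function:  `G_0(x) = x^{-2}`, `G_g(x) = 0` for `g ≥ 1`, and
for `n ≥ 2`,
`G_g = Σ_{r+s=g} ((2r+n−3)!!/(4^s(2r+2s+n−1)!!)) P_r Δ^s` where
`P_r = (1/(2Σx_j)) Σ_{I⊔J={1..n}, I,J≠∅} (Σ_I x)²(Σ_J x)² Σ_{r'≤r} G_{r'}(x_I)G_{r−r'}(x_J)`. -/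
def Gf : (fuel : ℕ) → (n : ℕ) → ℕ → K n
  | _, 0, _ => 0
  | _, 1, 0 => (algebraMap (R 1) (K 1) (X 0)) ^ (-2 : ℤ)
  | _, 1, _+1 => 0
  | 0, _+2, _ => 0
  | fuel+1, n+2, g =>
      ∑ s ∈ Finset.range (g+1),
        (((Nat.doubleFactorial (2*(g-s)+(n+2)-3) : ℚ) /
          (4^s * (Nat.doubleFactorial (2*g+(n+2)-1) : ℚ))) : K (n+2)) *
        ((2 * SX (n+2))⁻¹ *
          ∑ I : Finset (Fin (n+2)),
            if I ≠ ∅ ∧ I ≠ univ then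
              (algebraMap (R (n+2)) (K (n+2)) (∑ i ∈ I, X i))^2 *
              (algebraMap (R (n+2)) (K (n+2)) (∑ i ∈ Iᶜ, X i))^2 *
              ∑ r' ∈ Finset.range ((g-s)+1),
                emb I (Gf fuel I.card r') * emb Iᶜ (Gf fuel Iᶜ.card ((g-s) - r'))
            else 0) *
        (Dlt (n+2))^s

/-- The normalized `n`-point function `G_g(x_1,…,x_n)` as an element of `ℚ(x_1,…,x_n)`. -/
def Gnpt (n g : ℕ) : K n := Gf n n g

/-- `P_r(x_1,…,x_n)`. -/
def Ppoly (n r : ℕ) : K n :=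
  (2 * SX n)⁻¹ *
    ∑ I : Finset (Fin n),
      if I ≠ ∅ ∧ I ≠ univ then
        (algebraMap (R n) (K n) (∑ i ∈ I, X i))^2 *
        (algebraMap (R n) (K n) (∑ i ∈ Iᶜ, X i))^2 *
        ∑ r' ∈ Finset.range (r+1), emb I (Gnpt I.card r') * emb Iᶜ (Gnpt Iᶜ.card (r - r'))
      else 0

/-- The `n`-point function `F_g(x_1,…,x_n) = Σ_{h+d=g} (1/d!)((Σx_j^3)/24)^d G_h(x_1,…,x_n)`. -/
def Fnpt (n g : ℕ) : K n :=
  ∑ d ∈ Finset.range (g+1),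
    ((1 / (Nat.factorial d : ℚ)) : K n) * (SX3 n / 24)^d * Gnpt n (g-d)

open Classical in
/-- The coefficient of the monomial `Π x_j^{d_j}` of an element of `ℚ(x_1,…,x_n)` which is
a polynomial (junk value `0` otherwise). -/
def coeffK {n : ℕ} (f : K n) (d : Fin n → ℕ) : ℚ :=
  if h : ∃ p : R n, algebraMap (R n) (K n) p = f then
    MvPolynomial.coeff (Finsupp.equivFunOnFinite.symm d) h.choose
  else 0

/-- The intersection index `⟨τ_{d_1} ⋯ τ_{d_n}⟩_g`, i.e. the coefficient of `Π x_j^{d_j}`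
in `F_g(x_1,…,x_n)`.  For `(g,n) = (0,1), (0,2)` and nonnegative `d_j` the value is `0`
(the conventional values `⟨τ_{-2}⟩_0 = 1`, `⟨τ_k τ_{-1-k}⟩_0 = (-1)^k` have a negative index). -/
def bracket (g : ℕ) {n : ℕ} (d : Fin n → ℕ) : ℚ :=
  if g = 0 ∧ n ≤ 2 then 0 else coeffK (Fnpt n g) d

/-- `⟨τ_j Π_{i ∈ I} τ_{d_i}⟩_g` for a subset `I ⊆ {1,…,n}`. -/
def bracketI (g : ℕ) {n : ℕ} (j : ℕ) (I : Finset (Fin n)) (d : Fin n → ℕ) : ℚ :=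
  bracket g (Fin.cons j (fun i : Fin I.card => d ((I.orderIsoOfFin rfl) i)))


/-! ### Laurent expansions in `y` (formal series in `ℚ[x_1,…,x_n][[y,y⁻¹]]` of bounded
`y`-degree, realized as Hahn/Laurent series in the variable `t = y⁻¹`, so that the
coefficient of `y^k` is the Hahn coefficient at `-k`). -/

/-- Laurent series in `t = y⁻¹` with coefficients in `ℚ[x_1,…,x_n]`. -/
abbrev Lau (n : ℕ) : Type := LaurentSeries (R n)

/-- The generalized binomial coefficient `C(p,k) = p(p−1)⋯(p−k+1)/k!` for `p : ℤ`, `k : ℕ`. -/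
def binomZ (p : ℤ) (k : ℕ) : ℚ := (∏ i ∈ Finset.range k, ((p : ℚ) - i)) / (Nat.factorial k)

/-- The expansion of `(y + c)^m = Σ_{k≥0} C(m,k) c^k y^{m−k}` as a Laurent series
in `t = y⁻¹` (for `m ≥ 0` this is the usual binomial expansion of the polynomial). -/
def yExpAdd {n : ℕ} (c : R n) (m : ℤ) : Lau n :=
  (HahnSeries.single (-m) (1 : R n)) *
    HahnSeries.ofPowerSeries ℤ (R n)
      (PowerSeries.mk fun k => MvPolynomial.C (binomZ m k) * c^k)

/-- The expansion of `(±y + c)^m`, where the sign is `+` if `σ = true` and `−` otherwise;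
it is computed as `(±1)^m (y ± c)^m`. -/
def LExp {n : ℕ} (σ : Bool) (c : R n) (m : ℤ) : Lau n :=
  (if σ then 1 else if Even m then 1 else -1 : Lau n) *
    yExpAdd ((if σ then 1 else -1 : R n) * c) m

open Classical in
/-- The polynomial representing an element of `ℚ(x_1,…,x_n)` lying in `ℚ[x_1,…,x_n]`
(junk value `0` otherwise). -/
def polyOf {n : ℕ} (f : K n) : R n :=
  if h : ∃ p : R n, algebraMap (R n) (K n) p = f then h.choose else 0

/-- `±y` as a Laurent series in `t = y⁻¹`. -/
def yLau (n : ℕ) (σ : Bool) : Lau n :=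
  (if σ then 1 else -1 : Lau n) * HahnSeries.single (-1 : ℤ) (1 : R n)

/-- The expansion of `F_g(±y, x_I)` as a Laurent series in `t = y⁻¹` with coefficients in
`ℚ[x_1,…,x_n]`: for `(g,|I|+1) = (0,1)` it is `(±y)^{-2} = y^{-2}`, for `(g,|I|+1) = (0,2)`
it is `1/(±y + x_i) = Σ_{k≥0} (−1)^k x_i^k (±y)^{−k−1}`, and otherwise it is obtained by
substituting `±y` and the variables of `I` into the polynomial `F_g`. -/
def FExp {n : ℕ} (σ : Bool) (g : ℕ) (I : Finset (Fin n)) : Lau n :=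
  if g = 0 ∧ I.card = 0 then HahnSeries.single (2 : ℤ) (1 : R n)
  else if g = 0 ∧ I.card = 1 then LExp σ (∑ i ∈ I, X i) (-1)
  else
    MvPolynomial.eval₂ ((HahnSeries.C).comp (algebraMap ℚ (R n)))
      (Fin.cons (yLau n σ)
        (fun i : Fin I.card => HahnSeries.C (X ((I.orderIsoOfFin rfl) i : Fin n))))
      (polyOf (Fnpt (I.card + 1) g))

/-- `L_g^{a,b}(y, x_1,…,x_n) = Σ_{g'=0}^{g} Σ_{I⊔J={1,…,n}} (y+Σ_I x)^a (−y+Σ_J x)^b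
F_{g'}(y,x_I) F_{g−g'}(−y,x_J)` as a Laurent series in `t = y⁻¹`. -/
def LL (g n : ℕ) (a b : ℤ) : Lau n :=
  ∑ gp ∈ Finset.range (g+1), ∑ I : Finset (Fin n),
    LExp true (∑ i ∈ I, X i) a * LExp false (∑ i ∈ Iᶜ, X i) b *
      FExp true gp I * FExp false (g - gp) Iᶜ

/-- The coefficient of `y^k Π_j x_j^{d_j}` in a Laurent series in `t = y⁻¹` with coefficients
in `ℚ[x_1,…,x_n]`. -/
def coeffL {n : ℕ} (f : Lau n) (k : ℤ) (d : Fin n → ℕ) : ℚ :=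
  MvPolynomial.coeff (Finsupp.equivFunOnFinite.symm d) (f.coeff (-k))

/-- The index of the variable `z_i` among the `a + b + n` variables `z, w, x`. -/
def zIdx (a b n : ℕ) (i : Fin a) : Fin (a+b+n) := ⟨i.1, by have := i.2; omega⟩

/-- The index of the variable `w_i` among the `a + b + n` variables `z, w, x`. -/
def wIdx (a b n : ℕ) (i : Fin b) : Fin (a+b+n) := ⟨a + i.1, by have := i.2; omega⟩

/-- The index of the variable `x_i` among the `a + b + n` variables `z, w, x`. -/
def xIdx (a b n : ℕ) (i : Fin n) : Fin (a+b+n) := ⟨a + b + i.1, by have := i.2; omega⟩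

/-- `L_g(y; z_1,…,z_a; w_1,…,w_b; x_1,…,x_n)
 = Σ_{g'=0}^{g} Σ_{I⊔J={1,…,n}} F_{g'}(y, z, x_I) F_{g−g'}(−y, w, x_J)`,
as a Laurent series in `t = y⁻¹` with coefficients in `ℚ[z,w,x]`. -/
def LLm (g n a b : ℕ) : Lau (a+b+n) :=
  ∑ gp ∈ Finset.range (g+1), ∑ I : Finset (Fin n),
    FExp true gp ((univ.image (zIdx a b n)) ∪ I.image (xIdx a b n)) *
    FExp false (g - gp) ((univ.image (wIdx a b n)) ∪ Iᶜ.image (xIdx a b n))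

/-- The exponent vector of the monomial `Π z_j^{r_j} Π w_j^{s_j} Π x_j^{d_j}`. -/
def expVec (a b n : ℕ) (r : Fin a → ℕ) (s : Fin b → ℕ) (d : Fin n → ℕ) :
    Fin (a+b+n) → ℕ :=
  fun v =>
    if h : v.1 < a then r ⟨v.1, h⟩
    else if h2 : v.1 < a + b then s ⟨v.1 - a, by omega⟩
    else d ⟨v.1 - (a+b), by have := v.2; omega⟩



lemma sum_powerset_sdiff_swap {ι M : Type*} [DecidableEq ι] [AddCommMonoid M] (s : Finset ι)
    (F : Finset ι → Finset ι → M) :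
    ∑ I ∈ s.powerset, F I (s \ I) = ∑ I ∈ s.powerset, F (s \ I) I := by
  refine Finset.sum_nbij' (s \ ·) (s \ ·) ?_ ?_ ?_ ?_ ?_ <;>
    simp +contextual

/-- Both sides sum over ordered decompositions of `s` into three parts. -/
lemma sum_powerset_powerset {ι M : Type*} [DecidableEq ι] [AddCommMonoid M] (s : Finset ι)
    (F : Finset ι → Finset ι → Finset ι → M) :
    ∑ I ∈ s.powerset, ∑ J ∈ I.powerset, F J (I \ J) (s \ I) =
      ∑ J ∈ s.powerset, ∑ L ∈ (s \ J).powerset, F J L ((s \ J) \ L) := by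
  rw [Finset.sum_sigma', Finset.sum_sigma']
  refine Finset.sum_bij' (fun p _ => ⟨p.2, p.1 \ p.2⟩) (fun p _ => ⟨p.1 ∪ p.2, p.1⟩) ?_ ?_ ?_ ?_ ?_
  · rintro ⟨I, J⟩ h
    simp only [Finset.mem_sigma, Finset.mem_powerset] at h ⊢
    exact ⟨h.2.trans h.1, Finset.sdiff_subset_sdiff h.1 subset_rfl⟩
  · rintro ⟨J, L⟩ h
    simp only [Finset.mem_sigma, Finset.mem_powerset] at h ⊢
    exact ⟨Finset.union_subset h.1 (h.2.trans Finset.sdiff_subset), Finset.subset_union_left⟩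
  · rintro ⟨I, J⟩ h
    simp only [Finset.mem_sigma, Finset.mem_powerset] at h
    simp [Finset.union_sdiff_of_subset h.2]
  · rintro ⟨J, L⟩ h
    simp only [Finset.mem_sigma, Finset.mem_powerset] at h
    have : Disjoint J L := (Finset.disjoint_sdiff).mono_right h.2
    simp [Finset.union_sdiff_cancel_left this]
  · rintro ⟨I, J⟩ h
    simp only [Finset.mem_sigma, Finset.mem_powerset] at h
    simp only
    congr 1
    rw [sdiff_sdiff_left, Finset.sup_eq_union, Finset.union_sdiff_of_subset h.2]

lemma sum_powerset_map {ι κ M : Type*} [DecidableEq ι] [DecidableEq κ] [AddCommMonoid M]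
    (e : κ ↪ ι) (s : Finset κ) (F : Finset ι → M) :
    ∑ I ∈ (s.map e).powerset, F I = ∑ I ∈ s.powerset, F (I.map e) := by
  symm
  refine Finset.sum_nbij (fun I => I.map e) ?_ ?_ ?_ ?_
  · intro I hI
    simpa using hI
  · intro I _ J _ h
    exact Finset.map_injective e h
  · intro I hI
    obtain ⟨J, hJ, rfl⟩ := Finset.subset_map_iff.1 (Finset.mem_powerset.1 hI)
    exact ⟨J, by simpa using hJ, rfl⟩
  · intro _ _
    rfl

/-- The convolution `(f ⋆ h)(s) = Σ_{I ⊔ J = s} f(I) h(J)` of functions on finite sets. -/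
def setConv {ι B : Type*} [DecidableEq ι] [CommRing B] (f h : Finset ι → B) : Finset ι → B :=
  fun s => ∑ I ∈ s.powerset, f I * h (s \ I)

lemma setConv_comm {ι B : Type*} [DecidableEq ι] [CommRing B] (f h : Finset ι → B) :
    setConv f h = setConv h f := by
  funext s
  rw [setConv, sum_powerset_sdiff_swap s (fun I J => f I * h J)]
  exact Finset.sum_congr rfl fun I _ => mul_comm _ _

lemma setConv_assoc {ι B : Type*} [DecidableEq ι] [CommRing B] (f h k : Finset ι → B) :
    setConv (setConv f h) k = setConv f (setConv h k) := by
  funext s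
  simp only [setConv, Finset.sum_mul, Finset.mul_sum]
  rw [sum_powerset_powerset s (fun I J L => f I * h J * k L)]
  simp only [mul_assoc]

lemma setConv_insert {ι B : Type*} [DecidableEq ι] [CommRing B] (f : Finset ι → B) {p : ι}
    {s : Finset ι} (hp : p ∉ s) :
    setConv f f (insert p s) = 2 * ∑ I ∈ s.powerset, f I * f (insert p (s \ I)) := by
  rw [setConv, Finset.sum_powerset_insert hp, two_mul]
  congr 1
  · refine Finset.sum_congr rfl fun I hI => ?_
    rw [Finset.insert_sdiff_of_notMem _ fun h => hp (Finset.mem_powerset.1 hI h)]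
  · rw [sum_powerset_sdiff_swap s (fun I J => f I * f (insert p J))]
    refine Finset.sum_congr rfl fun I hI => ?_
    have h : insert p s \ insert p I = s \ I := by grind
    rw [h, mul_comm]

/-- Multiplication of `f(s)` by `Σ_{i ∈ s} v_i`. -/
def sumMul {ι A : Type*} [CommRing A] (v : ι → A) (f : Finset ι → PowerSeries A) :
    Finset ι → PowerSeries A :=
  fun s => PowerSeries.C (∑ i ∈ s, v i) * f s

/-- The Euler operator `2 λ ∂_λ + |s|` on functions of finite sets with values in `A[[λ]]`. -/
def eulerOp {ι A : Type*} [CommRing A] (f : Finset ι → PowerSeries A) :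
    Finset ι → PowerSeries A :=
  fun s => 2 * (PowerSeries.X * PowerSeries.derivative A (f s)) + (s.card : PowerSeries A) * f s

lemma sumMul_setConv {ι A : Type*} [DecidableEq ι] [CommRing A] (v : ι → A)
    (f h : Finset ι → PowerSeries A) (s : Finset ι) :
    sumMul v (setConv f h) s = setConv (sumMul v f) h s + setConv f (sumMul v h) s := by
  simp only [sumMul, setConv, Finset.mul_sum, ← Finset.sum_add_distrib]
  refine Finset.sum_congr rfl fun I hI => ?_
  rw [← Finset.sum_sdiff (Finset.mem_powerset.1 hI), map_add]
  ring

lemma eulerOp_setConv {ι A : Type*} [DecidableEq ι] [CommRing A]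
    (f h : Finset ι → PowerSeries A) (s : Finset ι) :
    eulerOp (setConv f h) s = setConv (eulerOp f) h s + setConv f (eulerOp h) s := by
  simp only [eulerOp, setConv, Finset.mul_sum, ← Finset.sum_add_distrib, map_sum]
  refine Finset.sum_congr rfl fun I hI => ?_
  rw [← Finset.card_sdiff_add_card_eq_card (Finset.mem_powerset.1 hI), Derivation.leibniz]
  push_cast
  simp only [smul_eq_mul]
  ring

/-- If `u` solves the Euler form of the KdV equation, then `u ⋆ u` is a total derivative up to
the Euler operator. -/
lemma eulerOp_setConv_self {ι A : Type*} [DecidableEq ι] [CommRing A] (v : ι → A)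
    (u : Finset ι → PowerSeries A)
    (hu : ∀ s, 12 * eulerOp u s = 12 * u s + 6 * sumMul v (setConv u u) s +
      PowerSeries.X * sumMul v (sumMul v (sumMul v u)) s) (s : Finset ι) :
    12 * eulerOp (setConv u u) s = 24 * setConv u u s + PowerSeries.C (∑ i ∈ s, v i) *
      (8 * setConv u (setConv u u) s +
        2 * PowerSeries.X * setConv u (sumMul v (sumMul v u)) s -
        PowerSeries.X * setConv (sumMul v u) (sumMul v u) s) := by
  have h1 : setConv u (eulerOp u) s * 12 = 12 * setConv u u s +
      6 * setConv u (sumMul v (setConv u u)) s +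
      PowerSeries.X * setConv u (sumMul v (sumMul v (sumMul v u))) s := by
    simp only [setConv, Finset.mul_sum, Finset.sum_mul, ← Finset.sum_add_distrib]
    refine Finset.sum_congr rfl fun I _ => ?_
    have := hu (s \ I)
    linear_combination u I * this
  have h2 : setConv u (sumMul v (setConv u u)) s = 2 * setConv u (setConv u (sumMul v u)) s := by
    have : sumMul v (setConv u u) = fun t => 2 * setConv u (sumMul v u) t := by
      funext t
      rw [sumMul_setConv, setConv_comm (sumMul v u), two_mul]
    rw [this]
    simp only [setConv, Finset.mul_sum]
    refine Finset.sum_congr rfl fun I _ => Finset.sum_congr rfl fun J _ => ?_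
    ring
  have h3 := sumMul_setConv v u (setConv u u) s
  have h4 := sumMul_setConv v u (sumMul v (sumMul v u)) s
  have h5 := sumMul_setConv v (sumMul v u) (sumMul v u) s
  rw [setConv_comm (sumMul v u) (setConv u u), setConv_assoc] at h3
  rw [setConv_comm (sumMul v (sumMul v u))] at h5
  rw [eulerOp_setConv, setConv_comm (eulerOp u)]
  have e1 : sumMul v (setConv u (setConv u u)) s =
    PowerSeries.C (∑ i ∈ s, v i) * setConv u (setConv u u) s := rfl
  have e2 : sumMul v (setConv u (sumMul v (sumMul v u))) s =
    PowerSeries.C (∑ i ∈ s, v i) * setConv u (sumMul v (sumMul v u)) s := rfl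
  have e3 : sumMul v (setConv (sumMul v u) (sumMul v u)) s =
    PowerSeries.C (∑ i ∈ s, v i) * setConv (sumMul v u) (sumMul v u) s := rfl
  rw [e1] at h3
  rw [e2] at h4
  rw [e3] at h5
  linear_combination 2 * h1 + 4 * h2 - 8 * h3 - 2 * PowerSeries.X * h4 +
    PowerSeries.X * h5

/-- The coefficients of the solution `U` of the Euler form
`(2 λ ∂_λ + |s| - 1) U(s) = (Σ_s v / 2) (U ⋆ U)(s) + λ (Σ_s v)³ / 12 · U(s)`
of the KdV equation with `U({i}) = 1 + O(λ)`. -/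
def kdvCoeff {ι A : Type*} [DecidableEq ι] [CommRing A] [Algebra ℚ A] (v : ι → A)
    (s : Finset ι) (g : ℕ) : A :=
  if s.card = 1 ∧ g = 0 then 1 else
  (12 * (2 * g + s.card - 1) : ℚ)⁻¹ •
    (6 * (∑ i ∈ s, v i) * (∑ I ∈ s.powerset,
        if _h : I ⊆ s ∧ I ≠ ∅ ∧ I ≠ s then
          ∑ r ∈ range (g + 1), kdvCoeff v I r * kdvCoeff v (s \ I) (g - r)
        else 0) +
      (∑ i ∈ s, v i) ^ 3 * (if _h : 0 < g then kdvCoeff v s (g - 1) else 0))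
termination_by (s.card, g)
decreasing_by
  · exact Prod.Lex.left _ _ (Finset.card_lt_card (_h.1.ssubset_of_ne _h.2.2))
  · refine Prod.Lex.left _ _ (Finset.card_lt_card ?_)
    exact Finset.sdiff_ssubset _h.1 (Finset.nonempty_iff_ne_empty.2 _h.2.1)
  · exact Prod.Lex.right _ (by omega)

/-- The generating series `U(s) = Σ_g λ^g U_g(s)`. -/
def kdvSeries {ι A : Type*} [DecidableEq ι] [CommRing A] [Algebra ℚ A] (v : ι → A)
    (s : Finset ι) : PowerSeries A :=
  PowerSeries.mk (kdvCoeff v s)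

lemma kdvCoeff_empty {ι A : Type*} [DecidableEq ι] [CommRing A] [Algebra ℚ A] (v : ι → A)
    (g : ℕ) : kdvCoeff v ∅ g = 0 := by
  rw [kdvCoeff]
  simp

lemma kdvSeries_empty {ι A : Type*} [DecidableEq ι] [CommRing A] [Algebra ℚ A] (v : ι → A) :
    kdvSeries v ∅ = 0 := by
  ext g
  simp [kdvSeries, kdvCoeff_empty]

lemma kdvCoeff_card_one {ι A : Type*} [DecidableEq ι] [CommRing A] [Algebra ℚ A] (v : ι → A)
    {s : Finset ι} (hs : s.card = 1) : kdvCoeff v s 0 = 1 := by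
  rw [kdvCoeff]
  simp [hs]

lemma coeff_two_mul_X_mul_derivative {A : Type*} [CommRing A] (f : PowerSeries A) (g : ℕ) :
    PowerSeries.coeff g (2 * (PowerSeries.X * PowerSeries.derivative A f)) =
      2 * g * PowerSeries.coeff g f := by
  have h2 : (2 : PowerSeries A) = PowerSeries.C 2 := (map_ofNat PowerSeries.C 2).symm
  rw [h2, PowerSeries.coeff_C_mul]
  cases g with
  | zero => simp
  | succ g =>
    rw [PowerSeries.coeff_succ_X_mul, PowerSeries.coeff_derivative]
    push_cast
    ring

lemma setConv_kdvSeries_eq {ι A : Type*} [DecidableEq ι] [CommRing A] [Algebra ℚ A] (v : ι → A)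
    (s : Finset ι) (g : ℕ) :
    PowerSeries.coeff g (setConv (kdvSeries v) (kdvSeries v) s) = ∑ I ∈ s.powerset,
      if I ⊆ s ∧ I ≠ ∅ ∧ I ≠ s then
        ∑ r ∈ range (g + 1), kdvCoeff v I r * kdvCoeff v (s \ I) (g - r) else 0 := by
  rw [setConv, map_sum]
  refine Finset.sum_congr rfl fun I hI => ?_
  have hI' := Finset.mem_powerset.1 hI
  split_ifs with h
  · rw [PowerSeries.coeff_mul, Finset.Nat.sum_antidiagonal_eq_sum_range_succ_mk]
    simp [kdvSeries]
  · by_cases h0 : I = ∅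
    · simp [h0, kdvSeries_empty]
    · have : I = s := by by_contra h1; exact h ⟨hI', h0, h1⟩
      simp [this, kdvSeries_empty]

lemma kdvCoeff_eq {ι A : Type*} [DecidableEq ι] [CommRing A] [Algebra ℚ A] (v : ι → A)
    (s : Finset ι) (g : ℕ) :
    12 * (2 * g + s.card - 1) * kdvCoeff v s g =
      6 * (∑ i ∈ s, v i) * PowerSeries.coeff g (setConv (kdvSeries v) (kdvSeries v) s) +
      (∑ i ∈ s, v i) ^ 3 * PowerSeries.coeff g (PowerSeries.X * kdvSeries v s) := by
  have hX : PowerSeries.coeff g (PowerSeries.X * kdvSeries v s) =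
      if 0 < g then kdvCoeff v s (g - 1) else 0 := by
    cases g with
    | zero => simp
    | succ g => rw [PowerSeries.coeff_succ_X_mul]; simp [kdvSeries]
  rw [setConv_kdvSeries_eq, hX]
  by_cases h1 : s.card = 1 ∧ g = 0
  · obtain ⟨h, rfl⟩ := h1
    obtain ⟨i, rfl⟩ := Finset.card_eq_one.1 h
    have : ∀ I ∈ ({i} : Finset ι).powerset, (if I ⊆ {i} ∧ I ≠ ∅ ∧ I ≠ {i} then
        ∑ r ∈ range (0 + 1), kdvCoeff v I r * kdvCoeff v ({i} \ I) (0 - r) else 0) = 0 := by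
      intro I hI
      rw [if_neg]
      rintro ⟨h, h0, h1⟩
      exact (Finset.subset_singleton_iff.1 h).elim h0 h1
    rw [Finset.sum_eq_zero this]
    simp
  · rcases eq_or_ne s ∅ with rfl | hs
    · simp [kdvCoeff_empty]
    · rw [kdvCoeff, if_neg h1]
      have hq : (12 * (2 * g + s.card - 1) : ℚ) ≠ 0 := by
        have : 1 < 2 * g + s.card := by
          have := Finset.card_pos.2 (Finset.nonempty_iff_ne_empty.2 hs)
          omega
        have : (1 : ℚ) < 2 * g + s.card := by exact_mod_cast this
        have : (0 : ℚ) < 12 * (2 * g + s.card - 1) := by linarith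
        exact this.ne'
      have hc : (12 * (2 * g + s.card - 1) : A) =
          algebraMap ℚ A (12 * (2 * g + s.card - 1)) := by simp [map_ofNat]
      rw [hc, ← Algebra.smul_def, smul_smul, mul_inv_cancel₀ hq, one_smul]
      simp only [dite_eq_ite]

lemma kdvSeries_eq {ι A : Type*} [DecidableEq ι] [CommRing A] [Algebra ℚ A] (v : ι → A)
    (s : Finset ι) :
    12 * eulerOp (kdvSeries v) s = 12 * kdvSeries v s +
      6 * sumMul v (setConv (kdvSeries v) (kdvSeries v)) s +
      PowerSeries.X * sumMul v (sumMul v (sumMul v (kdvSeries v))) s := by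
  have h12 : (12 : PowerSeries A) = PowerSeries.C 12 := (map_ofNat PowerSeries.C 12).symm
  have h6 : (6 : PowerSeries A) = PowerSeries.C 6 := (map_ofNat PowerSeries.C 6).symm
  have hc : (s.card : PowerSeries A) = PowerSeries.C (s.card : A) := by simp
  ext g
  have h := kdvCoeff_eq v s g
  have e : PowerSeries.X * sumMul v (sumMul v (sumMul v (kdvSeries v))) s =
      PowerSeries.C ((∑ i ∈ s, v i) ^ 3) * (PowerSeries.X * kdvSeries v s) := by
    simp only [sumMul, map_pow]
    ring
  rw [e]
  simp only [eulerOp, sumMul, mul_add, map_add, h12, h6, hc, PowerSeries.coeff_C_mul,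
    coeff_two_mul_X_mul_derivative]
  have hk : PowerSeries.coeff g (kdvSeries v s) = kdvCoeff v s g := by simp [kdvSeries]
  rw [hk]
  linear_combination h

/-- Naturality of `U` in the ring and in the labels. -/
lemma map_kdvCoeff {ι κ A B : Type*} [DecidableEq ι] [DecidableEq κ] [CommRing A] [CommRing B]
    [Algebra ℚ A] [Algebra ℚ B] (f : A →+* B) (e : κ ↪ ι) (v : κ → A) (w : ι → B)
    (s : Finset κ) (h : ∀ i ∈ s, w (e i) = f (v i)) (g : ℕ) :
    f (kdvCoeff v s g) = kdvCoeff w (s.map e) g := by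
  induction hn : s.card using Nat.strong_induction_on generalizing s g with
  | _ n ih =>
    subst hn
    induction g using Nat.strong_induction_on with
    | _ g ihg =>
      have hsum : ∑ i ∈ s.map e, w i = f (∑ i ∈ s, v i) := by
        rw [Finset.sum_map, map_sum]
        exact Finset.sum_congr rfl h
      rw [kdvCoeff.eq_def v s g, kdvCoeff.eq_def w (s.map e) g, Finset.card_map, hsum]
      by_cases h1 : s.card = 1 ∧ g = 0
      · rw [if_pos h1, if_pos h1, map_one]
      · rw [if_neg h1, if_neg h1, map_rat_smul, sum_powerset_map]
        congr 1
        simp only [map_add, map_mul, map_pow, map_sum, map_ofNat]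
        congr 2
        · refine Finset.sum_congr rfl fun I hI => ?_
          have hI' := Finset.mem_powerset.1 hI
          simp only [Finset.map_subset_map, Finset.map_eq_empty, Finset.map_inj, ne_eq]
          split_ifs with h2
          · rw [map_sum]
            refine Finset.sum_congr rfl fun r _ => ?_
            rw [map_mul, ih I.card (Finset.card_lt_card (hI'.ssubset_of_ne h2.2.2)) I
                (fun i hi => h i (hI' hi)) r rfl,
              ih (s \ I).card (Finset.card_lt_card
                (Finset.sdiff_ssubset hI' (Finset.nonempty_iff_ne_empty.2 h2.2.1))) (s \ I)
                (fun i hi => h i (Finset.sdiff_subset hi)) _ rfl, Finset.map_sdiff]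
          · simp
        · split_ifs with h2
          · exact ihg (g - 1) (by omega)
          · simp

lemma map_kdvSeries {ι κ A B : Type*} [DecidableEq ι] [DecidableEq κ] [CommRing A] [CommRing B]
    [Algebra ℚ A] [Algebra ℚ B] (f : A →+* B) (e : κ ↪ ι) (v : κ → A) (w : ι → B)
    (s : Finset κ) (h : ∀ i ∈ s, w (e i) = f (v i)) :
    PowerSeries.map f (kdvSeries v s) = kdvSeries w (s.map e) := by
  ext g
  simp [kdvSeries, map_kdvCoeff f e v w s h]

lemma sum_dvd_coeff_setConv_kdvSeries {ι A : Type*} [DecidableEq ι] [CommRing A] [Algebra ℚ A]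
    (v : ι → A) (s : Finset ι) (g : ℕ) (hg : 2 < 2 * g + s.card) :
    ∑ i ∈ s, v i ∣ PowerSeries.coeff g (setConv (kdvSeries v) (kdvSeries v) s) := by
  have h := congrArg (PowerSeries.coeff g)
    (eulerOp_setConv_self v (kdvSeries v) (kdvSeries_eq v) s)
  have h12 : (12 : PowerSeries A) = PowerSeries.C 12 := (map_ofNat PowerSeries.C 12).symm
  have h24 : (24 : PowerSeries A) = PowerSeries.C 24 := (map_ofNat PowerSeries.C 24).symm
  have hc : (s.card : PowerSeries A) = PowerSeries.C (s.card : A) := by simp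
  rw [h12, h24, map_add, PowerSeries.coeff_C_mul, PowerSeries.coeff_C_mul,
    PowerSeries.coeff_C_mul, eulerOp, map_add, coeff_two_mul_X_mul_derivative, hc,
    PowerSeries.coeff_C_mul] at h
  have hq : IsUnit (12 * (2 * g + s.card - 2) : A) := by
    have : (2 : ℚ) < 2 * g + s.card := by exact_mod_cast hg
    have : (0 : ℚ) < 12 * (2 * g + s.card - 2) := by linarith
    have := (IsUnit.mk0 _ this.ne').map (algebraMap ℚ A)
    simpa [map_ofNat] using this
  rw [← hq.dvd_mul_left]
  refine ⟨PowerSeries.coeff g (8 * setConv (kdvSeries v) (setConv (kdvSeries v) (kdvSeries v)) s +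
    2 * PowerSeries.X * setConv (kdvSeries v) (sumMul v (sumMul v (kdvSeries v))) s -
    PowerSeries.X * setConv (sumMul v (kdvSeries v)) (sumMul v (kdvSeries v)) s), ?_⟩
  linear_combination h

/-- `U_g(s)` is divisible by `(Σ_s v)²` in the stable range. -/
lemma exists_sum_sq_mul_eq_kdvCoeff {ι A : Type*} [DecidableEq ι] [CommRing A] [Algebra ℚ A]
    (v : ι → A) (s : Finset ι) (g : ℕ) (hg : 2 < 2 * g + s.card) :
    ∃ F : A, (∑ i ∈ s, v i) ^ 2 * F = kdvCoeff v s g := by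
  obtain ⟨c, hc⟩ := sum_dvd_coeff_setConv_kdvSeries v s g hg
  have h := kdvCoeff_eq v s g
  have hq : IsUnit (12 * (2 * g + s.card - 1) : A) := by
    have : (2 : ℚ) < 2 * g + s.card := by exact_mod_cast hg
    have : (0 : ℚ) < 12 * (2 * g + s.card - 1) := by linarith
    have := (IsUnit.mk0 _ this.ne').map (algebraMap ℚ A)
    simpa [map_ofNat] using this
  have : (∑ i ∈ s, v i) ^ 2 ∣ kdvCoeff v s g := by
    rw [← hq.dvd_mul_left, h, hc]
    exact ⟨6 * c + (∑ i ∈ s, v i) * PowerSeries.coeff g (PowerSeries.X * kdvSeries v s), by ring⟩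
  exact this.imp fun F hF => hF.symm

/-- The exponential series `exp(a λ)`. -/
def expSeries {A : Type*} [CommRing A] [Algebra ℚ A] (a : A) : PowerSeries A :=
  PowerSeries.rescale a (PowerSeries.exp A)

lemma coeff_expSeries {A : Type*} [CommRing A] [Algebra ℚ A] (a : A) (n : ℕ) :
    PowerSeries.coeff n (expSeries a) = a ^ n * algebraMap ℚ A (1 / n.factorial) := by
  rw [expSeries, PowerSeries.coeff_rescale, PowerSeries.coeff_exp]

lemma expSeries_add {A : Type*} [CommRing A] [Algebra ℚ A] (a b : A) :
    expSeries (a + b) = expSeries a * expSeries b :=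
  (PowerSeries.exp_mul_exp_eq_exp_add a b).symm

lemma expSeries_mul_neg {A : Type*} [CommRing A] [Algebra ℚ A] (a : A) :
    expSeries a * expSeries (-a) = 1 := by
  rw [← expSeries_add, add_neg_cancel, expSeries, PowerSeries.rescale_zero]
  simp

lemma derivative_expSeries {A : Type*} [CommRing A] [Algebra ℚ A] (a : A) :
    PowerSeries.derivative A (expSeries a) = PowerSeries.C a * expSeries a := by
  ext n
  rw [PowerSeries.coeff_derivative, PowerSeries.coeff_C_mul, coeff_expSeries, coeff_expSeries]
  have h : algebraMap ℚ A (1 / (n + 1).factorial) * (n + 1) =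
      algebraMap ℚ A (1 / n.factorial) := by
    have : (1 / (n + 1).factorial : ℚ) * (n + 1) = 1 / n.factorial := by
      rw [Nat.factorial_succ]
      push_cast
      field_simp
    rw [← this]
    simp
  rw [mul_assoc, h]
  ring

/-- The normalized series `exp(-λ Σ_s v³ / 24) U(s)`. -/
def normSeries {ι A : Type*} [DecidableEq ι] [CommRing A] [Algebra ℚ A] (v : ι → A)
    (s : Finset ι) : PowerSeries A :=
  expSeries (-(algebraMap ℚ A (1 / 24) * ∑ i ∈ s, v i ^ 3)) * kdvSeries v s

lemma normSeries_empty {ι A : Type*} [DecidableEq ι] [CommRing A] [Algebra ℚ A] (v : ι → A) :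
    normSeries v ∅ = 0 := by
  rw [normSeries, kdvSeries_empty, mul_zero]

lemma expSeries_mul_normSeries {ι A : Type*} [DecidableEq ι] [CommRing A] [Algebra ℚ A]
    (v : ι → A) (s : Finset ι) :
    expSeries (algebraMap ℚ A (1 / 24) * ∑ i ∈ s, v i ^ 3) * normSeries v s = kdvSeries v s := by
  rw [normSeries, ← mul_assoc, expSeries_mul_neg, one_mul]

lemma setConv_normSeries {ι A : Type*} [DecidableEq ι] [CommRing A] [Algebra ℚ A]
    (v : ι → A) (s : Finset ι) :
    setConv (normSeries v) (normSeries v) s =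
      expSeries (-(algebraMap ℚ A (1 / 24) * ∑ i ∈ s, v i ^ 3)) *
        setConv (kdvSeries v) (kdvSeries v) s := by
  rw [setConv, setConv, Finset.mul_sum]
  refine Finset.sum_congr rfl fun I hI => ?_
  rw [← Finset.sum_sdiff (Finset.mem_powerset.1 hI), mul_add, neg_add, expSeries_add,
    normSeries, normSeries]
  ring

lemma map_normSeries {ι κ A B : Type*} [DecidableEq ι] [DecidableEq κ] [CommRing A] [CommRing B]
    [Algebra ℚ A] [Algebra ℚ B] (f : A →+* B) (e : κ ↪ ι) (v : κ → A) (w : ι → B)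
    (s : Finset κ) (h : ∀ i ∈ s, w (e i) = f (v i)) :
    PowerSeries.map f (normSeries v s) = normSeries w (s.map e) := by
  rw [normSeries, normSeries, map_mul, map_kdvSeries f e v w s h]
  congr 1
  ext n
  rw [PowerSeries.coeff_map, coeff_expSeries, coeff_expSeries, map_mul, map_pow, map_neg,
    map_mul, RingHom.map_rat_algebraMap, RingHom.map_rat_algebraMap, map_sum, Finset.sum_map]
  have hsum : ∑ i ∈ s, w (e i) ^ 3 = ∑ i ∈ s, f (v i ^ 3) :=
    Finset.sum_congr rfl fun i hi => by rw [h i hi, map_pow]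
  rw [hsum]

lemma normSeries_eq {ι A : Type*} [DecidableEq ι] [CommRing A] [Algebra ℚ A] (v : ι → A)
    (s : Finset ι) (g : ℕ) :
    12 * (2 * g + s.card - 1) * PowerSeries.coeff g (normSeries v s) =
      6 * (∑ i ∈ s, v i) * PowerSeries.coeff g (setConv (normSeries v) (normSeries v) s) +
      ((∑ i ∈ s, v i) ^ 3 - ∑ i ∈ s, v i ^ 3) *
        PowerSeries.coeff g (PowerSeries.X * normSeries v s) := by
  set a : A := algebraMap ℚ A (1 / 24) * ∑ i ∈ s, v i ^ 3 with ha
  have ha' : ∑ i ∈ s, v i ^ 3 = 24 * a := by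
    rw [ha, ← mul_assoc, ← map_ofNat (algebraMap ℚ A) 24, ← map_mul]
    norm_num
  have h := kdvSeries_eq v s
  have key : 24 * (PowerSeries.X * PowerSeries.derivative A (normSeries v s)) +
      12 * PowerSeries.C (s.card : A) * normSeries v s = 12 * normSeries v s +
      6 * (PowerSeries.C (∑ i ∈ s, v i) * setConv (normSeries v) (normSeries v) s) +
      PowerSeries.C ((∑ i ∈ s, v i) ^ 3 - ∑ i ∈ s, v i ^ 3) *
        (PowerSeries.X * normSeries v s) := by
    rw [setConv_normSeries, normSeries, ← ha, ha', Derivation.leibniz, derivative_expSeries]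
    simp only [eulerOp, sumMul] at h
    simp only [smul_eq_mul, map_sub, map_mul, map_pow, map_neg, map_natCast, map_ofNat]
    linear_combination expSeries (-a) * h
  have h12 : (12 : PowerSeries A) = PowerSeries.C 12 := (map_ofNat PowerSeries.C 12).symm
  have h6 : (6 : PowerSeries A) = PowerSeries.C 6 := (map_ofNat PowerSeries.C 6).symm
  have e24 : 24 * (PowerSeries.X * PowerSeries.derivative A (normSeries v s)) =
    PowerSeries.C 12 * (2 * (PowerSeries.X * PowerSeries.derivative A (normSeries v s))) := by
    rw [← h12]
    ring
  have key' := congrArg (PowerSeries.coeff g) key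
  rw [e24, h12, h6] at key'
  simp only [map_add, mul_assoc, PowerSeries.coeff_C_mul, coeff_two_mul_X_mul_derivative] at key'
  linear_combination key'

lemma coeff_normSeries_card_one {ι A : Type*} [DecidableEq ι] [CommRing A] [Algebra ℚ A]
    (v : ι → A) (i : ι) (g : ℕ) :
    PowerSeries.coeff g (normSeries v {i}) = if g = 0 then 1 else 0 := by
  split_ifs with hg
  · subst hg
    simp [normSeries, PowerSeries.coeff_mul, coeff_expSeries, kdvSeries, kdvCoeff_card_one]
  · have h := normSeries_eq v {i} g
    have h0 : setConv (normSeries v) (normSeries v) {i} = 0 := by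
      rw [setConv]
      refine Finset.sum_eq_zero fun I hI => ?_
      rcases Finset.subset_singleton_iff.1 (Finset.mem_powerset.1 hI) with rfl | rfl <;>
        simp [normSeries_empty]
    rw [h0] at h
    have hu : IsUnit (24 * g : A) := by
      have : (24 * g : ℚ) ≠ 0 := by positivity
      have := (IsUnit.mk0 _ this).map (algebraMap ℚ A)
      simpa [map_ofNat] using this
    refine hu.mul_right_eq_zero.1 ?_
    simp only [Finset.card_singleton, Finset.sum_singleton, map_zero, sub_self] at h
    push_cast at h
    linear_combination h

/-- The variables `x_1,…,x_n` as elements of `K n`. -/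
def varK (n : ℕ) (i : Fin n) : K n := algebraMap (R n) (K n) (X i)

lemma SX_eq_sum_varK (n : ℕ) : SX n = ∑ i, varK n i := by
  simp [SX, varK]

lemma SX_ne_zero {n : ℕ} (hn : 0 < n) : SX n ≠ 0 := by
  rw [SX, Ne, map_eq_zero_iff _ (IsFractionRing.injective (R n) (K n))]
  intro h
  have := congrArg (MvPolynomial.eval (fun _ => (1 : ℚ))) h
  simp at this
  omega

lemma emb_varK {n : ℕ} (I : Finset (Fin n)) (i : Fin I.card) :
    emb I (varK I.card i) = varK n (I.orderEmbOfFin rfl i) := by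
  rw [varK, emb, IsFractionRing.lift_algebraMap]
  simp [embRH, varK]

lemma emb_coeff_normSeries {n : ℕ} (I : Finset (Fin n)) (g : ℕ) :
    emb I (PowerSeries.coeff g (normSeries (varK I.card) univ)) =
      PowerSeries.coeff g (normSeries (varK n) I) := by
  have h := map_normSeries (emb I) (I.orderEmbOfFin rfl).toEmbedding (varK I.card) (varK n) univ
    (fun i _ => (emb_varK I i).symm)
  rw [Finset.map_orderEmbOfFin_univ] at h
  rw [← h, PowerSeries.coeff_map]

lemma emb_SX {n : ℕ} (I : Finset (Fin n)) :
    emb I (SX I.card) = algebraMap (R n) (K n) (∑ i ∈ I, X i) := by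
  rw [SX_eq_sum_varK, map_sum, map_sum]
  simp only [emb_varK]
  conv_rhs => rw [← Finset.map_orderEmbOfFin_univ I rfl, Finset.sum_map]
  rfl

/-- The explicit solution of a two-term recursion by double factorials. -/
lemma eq_sum_doubleFactorial {F : Type*} [Field F] [CharZero F] (n : ℕ) (q N : ℕ → F) (D : F)
    (h0 : ((n : F) + 1) * N 0 = q 0)
    (h : ∀ g : ℕ, (2 * (g + 1) + n + 1 : F) * N (g + 1) = q (g + 1) + D / 4 * N g) (g : ℕ) :
    N g = ∑ s ∈ range (g + 1), ((Nat.doubleFactorial (2 * (g - s) + (n + 2) - 3) : F) /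
      (4 ^ s * (Nat.doubleFactorial (2 * g + (n + 2) - 1) : F))) * q (g - s) * D ^ s := by
  have hdf : ∀ g : ℕ, (Nat.doubleFactorial (2 * g + (n + 2) - 1) : F) =
      (2 * g + n + 1) * (Nat.doubleFactorial (2 * g + (n + 2) - 3) : F) := by
    intro g
    have : Nat.doubleFactorial (2 * g + (n + 2) - 1) =
        (2 * g + n + 1) * Nat.doubleFactorial (2 * g + (n + 2) - 3) := by
      rcases Nat.eq_zero_or_pos (2 * g + n) with h | h
      · obtain ⟨rfl, rfl⟩ : g = 0 ∧ n = 0 := by omega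
        simp
      · obtain ⟨m, hm⟩ : ∃ m, 2 * g + n = m + 1 := ⟨2 * g + n - 1, by omega⟩
        have e1 : 2 * g + (n + 2) - 1 = m + 2 := by omega
        have e2 : 2 * g + (n + 2) - 3 = m := by omega
        rw [e1, e2, hm, Nat.doubleFactorial_add_two]
    rw [this]
    push_cast
    ring
  have hne : ∀ m : ℕ, (Nat.doubleFactorial m : F) ≠ 0 := fun m =>
    Nat.cast_ne_zero.2 (Nat.doubleFactorial_pos m).ne'
  have hpos : ∀ g : ℕ, (2 * g + n + 1 : F) ≠ 0 := fun g => by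
    have := Nat.cast_ne_zero (R := F).2 (Nat.succ_ne_zero (2 * g + n))
    push_cast at this
    exact this
  have top : ∀ g : ℕ, (Nat.doubleFactorial (2 * g + (n + 2) - 3) : F) /
      (4 ^ 0 * (Nat.doubleFactorial (2 * g + (n + 2) - 1) : F)) = 1 / (2 * g + n + 1) := by
    intro g
    rw [hdf g]
    have := hne (2 * g + (n + 2) - 3)
    have := hpos g
    field_simp
  induction g with
  | zero =>
    have := top 0
    simp only [zero_add, Finset.sum_range_one, Nat.sub_self] at this ⊢
    rw [this, ← h0]
    have := hpos 0
    field_simp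
    push_cast
    ring
  | succ g ih =>
    rw [Finset.sum_range_succ']
    have ht := top (g + 1)
    simp only [Nat.sub_zero] at ht ⊢
    rw [ht]
    have hp := hpos (g + 1)
    have e : ∀ s ∈ range (g + 1),
        ((Nat.doubleFactorial (2 * (g + 1 - (s + 1)) + (n + 2) - 3) : F) /
          (4 ^ (s + 1) * (Nat.doubleFactorial (2 * (g + 1) + (n + 2) - 1) : F))) *
          q (g + 1 - (s + 1)) * D ^ (s + 1) =
        D / 4 / (2 * ((g + 1 : ℕ) : F) + n + 1) *
          (((Nat.doubleFactorial (2 * (g - s) + (n + 2) - 3) : F) /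
          (4 ^ s * (Nat.doubleFactorial (2 * g + (n + 2) - 1) : F))) * q (g - s) * D ^ s) := by
      intro s _
      rw [hdf (g + 1), Nat.add_sub_add_right]
      have e2 : 2 * (g + 1) + (n + 2) - 3 = 2 * g + (n + 2) - 1 := by omega
      rw [e2]
      have := hne (2 * g + (n + 2) - 1)
      field_simp
      ring
    rw [Finset.sum_congr rfl e, ← Finset.mul_sum, ← ih]
    have := h g
    push_cast at hp ⊢
    field_simp
    linear_combination 4 * this

lemma SX_sq_mul_Gf (fuel n g : ℕ) (hn : n ≤ fuel) :
    SX n ^ 2 * Gf fuel n g = PowerSeries.coeff g (normSeries (varK n) univ) := by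
  induction fuel generalizing n g with
  | zero =>
    obtain rfl : n = 0 := by omega
    simp [Gf, normSeries_empty]
  | succ fuel ih =>
    match n, g, hn with
    | 0, g, _ => simp [Gf, normSeries_empty]
    | 1, g, _ =>
      have h := coeff_normSeries_card_one (varK 1) 0 g
      rw [show (univ : Finset (Fin 1)) = {0} from rfl, h]
      cases g with
      | zero =>
        have h1 := SX_ne_zero one_pos
        have h2 : SX 1 = algebraMap (R 1) (K 1) (X 0) := by simp [SX]
        rw [h2] at h1
        rw [h2, Gf, if_pos rfl, zpow_neg]
        exact mul_inv_cancel₀ (pow_ne_zero 2 h1)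
      | succ g => simp [Gf]
    | n + 2, g, hn =>
      have hS := SX_ne_zero (Nat.succ_pos (n + 1))
      have hconv : ∀ r : ℕ, (∑ I : Finset (Fin (n+2)),
            if I ≠ ∅ ∧ I ≠ univ then
              (algebraMap (R (n+2)) (K (n+2)) (∑ i ∈ I, X i))^2 *
              (algebraMap (R (n+2)) (K (n+2)) (∑ i ∈ Iᶜ, X i))^2 *
              ∑ r' ∈ Finset.range (r+1),
                emb I (Gf fuel I.card r') * emb Iᶜ (Gf fuel Iᶜ.card (r - r'))
            else 0) = PowerSeries.coeff r
              (setConv (normSeries (varK (n + 2))) (normSeries (varK (n + 2))) univ) := by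
        intro r
        rw [setConv, map_sum, Finset.powerset_univ]
        refine Finset.sum_congr rfl fun I _ => ?_
        split_ifs with h
        · have hI : I.card ≤ fuel := by
            have := Finset.card_lt_card (I.ssubset_univ_iff.2 h.2)
            simp only [Finset.card_univ, Fintype.card_fin] at this
            omega
          have hJ : Iᶜ.card ≤ fuel := by
            have := Finset.card_compl I
            have := Finset.card_pos.2 (Finset.nonempty_iff_ne_empty.2 h.1)
            simp only [Fintype.card_fin] at *
            omega
          rw [PowerSeries.coeff_mul, Finset.Nat.sum_antidiagonal_eq_sum_range_succ_mk,
            Finset.mul_sum]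
          refine Finset.sum_congr rfl fun r' _ => ?_
          rw [← Finset.compl_eq_univ_sdiff, ← emb_coeff_normSeries I, ← emb_coeff_normSeries Iᶜ,
            ← ih _ _ hI, ← ih _ _ hJ, map_mul, map_mul, map_pow, map_pow, emb_SX, emb_SX]
          ring
        · rw [not_and_or, not_not, not_not] at h
          rcases h with rfl | rfl <;> simp [normSeries_empty]
      have hrec := normSeries_eq (varK (n + 2)) univ
      rw [← SX_eq_sum_varK] at hrec
      have hD : SX (n + 2) ^ 3 - ∑ i, varK (n + 2) i ^ 3 = 3 * Dlt (n + 2) := by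
        rw [Dlt, SX3]
        simp only [map_sum, map_pow, varK]
        ring
      rw [hD] at hrec
      simp only [Finset.card_univ, Fintype.card_fin] at hrec
      have key := eq_sum_doubleFactorial n
        (fun g => SX (n + 2) / 2 * PowerSeries.coeff g
          (setConv (normSeries (varK (n + 2))) (normSeries (varK (n + 2))) univ))
        (fun g => PowerSeries.coeff g (normSeries (varK (n + 2)) univ)) (Dlt (n + 2))
        (by
          have := hrec 0
          simp only [PowerSeries.coeff_zero_X_mul] at this
          push_cast at this
          linear_combination this / 12)
        (by
          intro g
          have := hrec (g + 1)
          rw [PowerSeries.coeff_succ_X_mul] at this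
          push_cast at this
          linear_combination this / 12) g
      rw [key, Gf, Finset.mul_sum]
      refine Finset.sum_congr rfl fun s _ => ?_
      rw [hconv]
      push_cast
      field_simp

lemma SX_sq_mul_Fnpt (n g : ℕ) : SX n ^ 2 * Fnpt n g = kdvCoeff (varK n) univ g := by
  have h := congrArg (PowerSeries.coeff g) (expSeries_mul_normSeries (varK n) univ)
  rw [PowerSeries.coeff_mul, Finset.Nat.sum_antidiagonal_eq_sum_range_succ_mk, kdvSeries,
    PowerSeries.coeff_mk] at h
  rw [← h, Fnpt, Finset.mul_sum]
  refine Finset.sum_congr rfl fun d _ => ?_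
  rw [← SX_sq_mul_Gf n n _ le_rfl, coeff_expSeries, Gnpt]
  have h3 : algebraMap ℚ (K n) (1 / 24) * ∑ i, varK n i ^ 3 = SX3 n / 24 := by
    rw [SX3]
    simp only [map_sum, map_pow, varK, map_div₀, map_one, map_ofNat]
    ring
  rw [h3]
  simp only [map_div₀, map_one, map_natCast]
  push_cast
  ring

/-- In the stable range `F_g(x_1,…,x_n)` is a polynomial, and `(Σ x_j)² F_g` is `U_g`. -/
lemma sum_sq_mul_polyOf_Fnpt (n g : ℕ) (hn : 0 < n) (hg : 2 < 2 * g + n) :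
    (∑ j, X j : R n) ^ 2 * polyOf (Fnpt n g) = kdvCoeff (X : Fin n → R n) univ g := by
  have hinj := IsFractionRing.injective (R n) (K n)
  obtain ⟨F, hF⟩ := exists_sum_sq_mul_eq_kdvCoeff (X : Fin n → R n) univ g (by simpa using hg)
  have hmap := map_kdvCoeff (algebraMap (R n) (K n)) (Function.Embedding.refl _)
    (X : Fin n → R n) (varK n) univ (fun _ _ => rfl) g
  rw [Finset.map_refl] at hmap
  have hFn : algebraMap (R n) (K n) F = Fnpt n g := by
    refine mul_left_cancel₀ (pow_ne_zero 2 (SX_ne_zero hn)) ?_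
    rw [SX_sq_mul_Fnpt, ← hmap, ← hF, map_mul, map_pow, SX]
  have hex : ∃ p : R n, algebraMap (R n) (K n) p = Fnpt n g := ⟨F, hFn⟩
  have : polyOf (Fnpt n g) = F := by
    rw [polyOf, dif_pos hex]
    exact hinj (hex.choose_spec.trans hFn.symm)
  rw [this, hF]

/-- `f` has degree at most `d` in `y`, for a Laurent series `f` in `t = y⁻¹`. -/
def DegLE {A : Type*} [CommRing A] (d : ℤ) (f : LaurentSeries A) : Prop :=
  ∀ k < -d, f.coeff k = 0

section DegLE

variable {A : Type*} [CommRing A] {d e : ℤ} {f f' : LaurentSeries A}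

lemma DegLE.mono (h : DegLE d f) (hde : d ≤ e) : DegLE e f := fun k hk => h k (by omega)

lemma DegLE.zero : DegLE d (0 : LaurentSeries A) := fun _ _ => rfl

lemma DegLE.add (h : DegLE d f) (h' : DegLE d f') : DegLE d (f + f') := fun k hk => by
  rw [HahnSeries.coeff_add, h k hk, h' k hk, add_zero]

lemma DegLE.sum {ι : Type*} {s : Finset ι} {F : ι → LaurentSeries A}
    (h : ∀ i ∈ s, DegLE d (F i)) : DegLE d (∑ i ∈ s, F i) :=
  Finset.sum_induction _ _ (fun _ _ => DegLE.add) DegLE.zero h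

lemma DegLE.mul (h : DegLE d f) (h' : DegLE e f') : DegLE (d + e) (f * f') := fun k hk => by
  rw [HahnSeries.coeff_mul]
  refine Finset.sum_eq_zero fun ij hij => ?_
  have hij' := (Finset.mem_antidiagonal.1 hij).2.2
  rcases lt_or_ge ij.1 (-d) with h1 | h1
  · rw [h _ h1, zero_mul]
  · rw [h' _ (by omega), mul_zero]

lemma DegLE.single (k : ℤ) (a : A) : DegLE (-k) (HahnSeries.single k a : LaurentSeries A) :=
  fun j hj => HahnSeries.coeff_single_of_ne (by omega)

lemma DegLE.const (a : A) : DegLE 0 (HahnSeries.C a : LaurentSeries A) := by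
  simpa using DegLE.single 0 a

lemma DegLE.natCast (n : ℕ) : DegLE 0 (n : LaurentSeries A) := by
  simpa using DegLE.const (n : A)

lemma DegLE.of_natCast_mul [IsDomain A] [CharZero A] {n : ℕ} (hn : n ≠ 0)
    (h : DegLE d ((n : LaurentSeries A) * f)) : DegLE d f := fun k hk => by
  have h1 := h k hk
  have h2 : (n : LaurentSeries A) = HahnSeries.C (n : A) := by simp
  rw [h2, HahnSeries.C_mul_eq_smul, HahnSeries.coeff_smul, smul_eq_mul] at h1
  exact (mul_eq_zero.1 h1).resolve_left (Nat.cast_ne_zero.2 hn)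

end DegLE

/-- `f(λ)` has degree at most `d`, where `λ` has degree `-2`. -/
def PDegLE {A : Type*} [CommRing A] (d : ℤ) (f : PowerSeries (LaurentSeries A)) : Prop :=
  ∀ g : ℕ, DegLE (d + 2 * g) (PowerSeries.coeff g f)

section PDegLE

variable {A : Type*} [CommRing A] {d e : ℤ} {f f' : PowerSeries (LaurentSeries A)}

lemma PDegLE.mono (h : PDegLE d f) (hde : d ≤ e) : PDegLE e f :=
  fun g => (h g).mono (by omega)

lemma PDegLE.zero : PDegLE d (0 : PowerSeries (LaurentSeries A)) := fun g => by
  rw [map_zero]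
  exact DegLE.zero

lemma PDegLE.mul (h : PDegLE d f) (h' : PDegLE e f') : PDegLE (d + e) (f * f') := fun g => by
  rw [PowerSeries.coeff_mul]
  refine DegLE.sum fun ij hij => ((h ij.1).mul (h' ij.2)).mono ?_
  have := Finset.HasAntidiagonal.mem_antidiagonal.1 hij
  omega

end PDegLE

/-- `y` as a Laurent series in `t = y⁻¹`. -/
def yGen (A : Type*) [CommRing A] : LaurentSeries A := HahnSeries.single (-1) 1

/-- Functions of `c` which are generated by functions of `y + c` and constants,
and have degree at most `d` in `y`. -/
inductive HasWeight {A : Type*} [CommRing A] : ℤ → (A → LaurentSeries A) → Prop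
  | lin : HasWeight 1 fun c => yGen A + HahnSeries.C c
  | inv (ψ : A → LaurentSeries A) (h : ∀ c, (yGen A + HahnSeries.C c) * ψ c = 1)
      (hd : ∀ c, DegLE (-1) (ψ c)) : HasWeight (-1) ψ
  | const (d : ℤ) (f : LaurentSeries A) (hf : DegLE d f) : HasWeight d fun _ => f
  | add {d : ℤ} {φ ψ : A → LaurentSeries A} (h : HasWeight d φ) (h' : HasWeight d ψ) :
      HasWeight d fun c => φ c + ψ c
  | mul {d e : ℤ} {φ ψ : A → LaurentSeries A} (h : HasWeight d φ) (h' : HasWeight e ψ) :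
      HasWeight (d + e) fun c => φ c * ψ c
  | shift {d : ℤ} {φ : A → LaurentSeries A} (h : HasWeight d φ) (s : A) :
      HasWeight d fun c => φ (c + s)
  | mono {d e : ℤ} {φ : A → LaurentSeries A} (h : HasWeight d φ) (hde : d ≤ e) : HasWeight e φ

section HasWeight

variable {A : Type*} [CommRing A] {d : ℤ} {φ ψ : A → LaurentSeries A}

lemma HasWeight.congr (h : HasWeight d φ) {e : ℤ} (he : d = e) (hψ : ∀ c, φ c = ψ c) :
    HasWeight e ψ := by
  obtain rfl : φ = ψ := funext hψ
  exact he ▸ h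

lemma HasWeight.degLE (h : HasWeight d φ) (c : A) : DegLE d (φ c) := by
  induction h generalizing c with
  | lin => exact (DegLE.single (-1) 1).add ((DegLE.const c).mono (by omega))
  | inv ψ h hd => exact hd c
  | const d f hf => exact hf
  | add _ _ h h' => exact (h c).add (h' c)
  | mul _ _ h h' => exact (h c).mul (h' c)
  | shift _ s h => exact h (c + s)
  | mono _ hde h => exact (h c).mono hde

/-- Differences lower the degree. -/
lemma HasWeight.diff (h : HasWeight d φ) (s : A) :
    HasWeight (d - 1) fun c => φ (c + s) - φ c := by
  induction h with
  | lin =>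
    refine (HasWeight.const 0 (HahnSeries.C s) (DegLE.const s)).congr (by omega) fun c => ?_
    simp only [map_add]
    ring
  | inv ψ h hd =>
    have hψ := HasWeight.inv ψ h hd
    refine ((HasWeight.const 0 (HahnSeries.C (-s)) (DegLE.const _)).mul
      (hψ.mul (hψ.shift s))).congr (by omega) fun c => ?_
    have h1 := h c
    have h2 := h (c + s)
    rw [map_add] at h2
    rw [map_neg]
    linear_combination ψ (c + s) * h1 - ψ c * h2
  | const d f hf => exact (HasWeight.const (d - 1) 0 DegLE.zero).congr rfl fun c => by simp
  | add _ _ h h' => exact (h.add h').congr rfl fun c => by ring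
  | @mul d e φ ψ hφ hψ h h' =>
    refine (((h.mul (hψ.shift s)).congr (e := d + e - 1) (by omega) fun _ => rfl).add
      ((hφ.mul h').congr (by omega) fun _ => rfl)).congr rfl fun c => ?_
    ring
  | shift _ t h => exact (h.shift t).congr rfl fun c => by rw [add_right_comm]
  | mono _ hde h => exact h.mono (by omega)

end HasWeight

/-- The sum `Σ_{I ⊔ J = Y, Z ⊆ I, W ⊆ J} φ(x_I) p(I) q(J)`. -/
def pairSum {κ A : Type*} [DecidableEq κ] [CommRing A] (x : κ → A)
    (p q : Finset κ → PowerSeries (LaurentSeries A)) (φ : A → LaurentSeries A)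
    (Y Z W : Finset κ) : PowerSeries (LaurentSeries A) :=
  ∑ I ∈ Y.powerset, if Z ⊆ I ∧ W ⊆ Y \ I then
    PowerSeries.C (φ (∑ i ∈ I, x i)) * p I * q (Y \ I) else 0

lemma pairSum_add {κ A : Type*} [DecidableEq κ] [CommRing A] (x : κ → A)
    (p q : Finset κ → PowerSeries (LaurentSeries A)) (φ ψ : A → LaurentSeries A)
    (Y Z W : Finset κ) : pairSum x p q φ Y Z W + pairSum x p q ψ Y Z W =
      pairSum x p q (fun c => φ c + ψ c) Y Z W := by
  rw [pairSum, pairSum, pairSum, ← Finset.sum_add_distrib]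
  refine Finset.sum_congr rfl fun I _ => ?_
  split_ifs
  · rw [map_add]
    ring
  · rw [add_zero]

lemma pairSum_eq_zero_left {κ A : Type*} [DecidableEq κ] [CommRing A] (x : κ → A)
    (p q : Finset κ → PowerSeries (LaurentSeries A)) (φ : A → LaurentSeries A)
    {Y Z W : Finset κ} (h : ¬ Z ⊆ Y) : pairSum x p q φ Y Z W = 0 :=
  Finset.sum_eq_zero fun _ hI =>
    if_neg fun hZ => h (hZ.1.trans (Finset.mem_powerset.1 hI))

lemma pairSum_eq_zero_right {κ A : Type*} [DecidableEq κ] [CommRing A] (x : κ → A)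
    (p q : Finset κ → PowerSeries (LaurentSeries A)) (φ : A → LaurentSeries A)
    {Y Z W : Finset κ} (h : ¬ W ⊆ Y) : pairSum x p q φ Y Z W = 0 :=
  Finset.sum_eq_zero fun _ _ => if_neg fun hZ => h (hZ.2.trans Finset.sdiff_subset)

/-- The Euler form of the linearized KdV equation, with the extra point carrying `η`. -/
def LinKdV {κ A : Type*} [DecidableEq κ] [CommRing A] (x : κ → A) (η : LaurentSeries A)
    (u p : Finset κ → PowerSeries (LaurentSeries A)) : Prop :=
  ∀ Y : Finset κ, 24 * (PowerSeries.X * PowerSeries.derivative _ (p Y)) +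
      12 * (Y.card : PowerSeries (LaurentSeries A)) * p Y =
    12 * PowerSeries.C (η + HahnSeries.C (∑ i ∈ Y, x i)) *
        (∑ J ∈ Y.powerset, u J * p (Y \ J)) +
      PowerSeries.X * PowerSeries.C ((η + HahnSeries.C (∑ i ∈ Y, x i)) ^ 3) * p Y

lemma sum_left_pairSum {κ A : Type*} [DecidableEq κ] [CommRing A] (x : κ → A)
    (u p q : Finset κ → PowerSeries (LaurentSeries A)) (φ : A → LaurentSeries A)
    (Y Z W : Finset κ) :
    ∑ I ∈ Y.powerset, (if Z ⊆ I ∧ W ⊆ Y \ I then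
      PowerSeries.C (φ (∑ i ∈ I, x i)) * (∑ J ∈ I.powerset, u J * p (I \ J)) * q (Y \ I)
      else 0) =
    ∑ J ∈ Y.powerset, u J *
      pairSum x p q (fun c => φ (c + ∑ i ∈ J, x i)) (Y \ J) (Z \ J) W := by
  have h := sum_powerset_powerset Y fun J L M => if Z ⊆ J ∪ L ∧ W ⊆ M then
    PowerSeries.C (φ (∑ i ∈ L, x i + ∑ i ∈ J, x i)) * (u J * p L) * q M else 0
  refine Eq.trans ?_ (h.trans ?_)
  · refine Finset.sum_congr rfl fun I _ => ?_
    split_ifs with hc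
    · rw [Finset.mul_sum, Finset.sum_mul]
      refine Finset.sum_congr rfl fun J hJ => ?_
      rw [Finset.union_sdiff_of_subset (Finset.mem_powerset.1 hJ), if_pos hc,
        Finset.sum_sdiff (Finset.mem_powerset.1 hJ)]
    · refine (Finset.sum_eq_zero fun J hJ => ?_).symm
      rw [Finset.union_sdiff_of_subset (Finset.mem_powerset.1 hJ), if_neg hc]
  · refine Finset.sum_congr rfl fun J _ => ?_
    rw [pairSum, Finset.mul_sum]
    refine Finset.sum_congr rfl fun L _ => ?_
    have hJ : ∀ {V V' : Finset κ}, V \ J ⊆ V' ↔ V ⊆ J ∪ V' := sdiff_le_iff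
    simp only [hJ]
    split_ifs
    · ring
    · rw [mul_zero]

lemma sum_right_pairSum {κ A : Type*} [DecidableEq κ] [CommRing A] (x : κ → A)
    (u p q : Finset κ → PowerSeries (LaurentSeries A)) (φ : A → LaurentSeries A)
    (Y Z W : Finset κ) :
    ∑ I ∈ Y.powerset, (if Z ⊆ I ∧ W ⊆ Y \ I then
      PowerSeries.C (φ (∑ i ∈ I, x i)) * p I * (∑ J ∈ (Y \ I).powerset, u J * q ((Y \ I) \ J))
      else 0) =
    ∑ J ∈ Y.powerset, u J * pairSum x p q φ (Y \ J) Z (W \ J) := by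
  have h := sum_powerset_powerset Y fun J L M => if Z ⊆ M ∧ W ⊆ J ∪ L then
    PowerSeries.C (φ (∑ i ∈ M, x i)) * p M * (u J * q L) else 0
  have h0 := sum_powerset_sdiff_swap Y fun I M => ∑ J ∈ I.powerset,
    if Z ⊆ M ∧ W ⊆ J ∪ (I \ J) then
    PowerSeries.C (φ (∑ i ∈ M, x i)) * p M * (u J * q (I \ J)) else 0
  refine Eq.trans ?_ ((h0.symm.trans h).trans ?_)
  · refine Finset.sum_congr rfl fun I _ => ?_
    split_ifs with hc
    · rw [Finset.mul_sum]
      refine Finset.sum_congr rfl fun J hJ => ?_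
      rw [Finset.union_sdiff_of_subset (Finset.mem_powerset.1 hJ), if_pos hc]
    · refine (Finset.sum_eq_zero fun J hJ => ?_).symm
      rw [Finset.union_sdiff_of_subset (Finset.mem_powerset.1 hJ), if_neg hc]
  · refine Finset.sum_congr rfl fun J _ => ?_
    have h1 := sum_powerset_sdiff_swap (Y \ J) fun L M => if Z ⊆ M ∧ W ⊆ J ∪ L then
      PowerSeries.C (φ (∑ i ∈ M, x i)) * p M * (u J * q L) else 0
    rw [h1, pairSum, Finset.mul_sum]
    refine Finset.sum_congr rfl fun L _ => ?_
    have hJ : ∀ {V V' : Finset κ}, V \ J ⊆ V' ↔ V ⊆ J ∪ V' := sdiff_le_iff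
    simp only [hJ]
    split_ifs
    · ring
    · rw [mul_zero]

/-- The recursion satisfied by `pairSum`. -/
lemma eulerOp_pairSum {κ A : Type*} [DecidableEq κ] [CommRing A] (x : κ → A)
    (u p q : Finset κ → PowerSeries (LaurentSeries A)) (hp : LinKdV x (yGen A) u p)
    (hq : LinKdV x (-yGen A) u q) (φ : A → LaurentSeries A) (Y Z W : Finset κ) :
    24 * (PowerSeries.X * PowerSeries.derivative _ (pairSum x p q φ Y Z W)) +
      12 * (Y.card : PowerSeries (LaurentSeries A)) * pairSum x p q φ Y Z W =
    12 * ∑ J ∈ Y.powerset, u J *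
      (pairSum x p q (fun c => φ (c + ∑ i ∈ J, x i) *
          (yGen A + HahnSeries.C (c + ∑ i ∈ J, x i))) (Y \ J) (Z \ J) W +
        pairSum x p q (fun c => φ c * (HahnSeries.C (∑ i ∈ Y, x i) - (yGen A + HahnSeries.C c)))
          (Y \ J) Z (W \ J)) +
      PowerSeries.X * pairSum x p q (fun c => φ c * ((yGen A + HahnSeries.C c) ^ 3 +
        (HahnSeries.C (∑ i ∈ Y, x i) - (yGen A + HahnSeries.C c)) ^ 3)) Y Z W := by
  simp only [mul_add (u _), Finset.sum_add_distrib]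
  rw [mul_add (12 : PowerSeries (LaurentSeries A)), ← sum_left_pairSum x u p q (fun c => φ c * (yGen A + HahnSeries.C c)),
    ← sum_right_pairSum]
  simp only [pairSum]
  rw [map_sum (PowerSeries.derivative (LaurentSeries A))]
  simp only [Finset.mul_sum, ← Finset.sum_add_distrib]
  refine Finset.sum_congr rfl fun I hI => ?_
  have hI' := Finset.mem_powerset.1 hI
  split_ifs with hc
  · have h1 := hp I
    have h2 := hq (Y \ I)
    have hcard : (Y.card : PowerSeries (LaurentSeries A)) = I.card + (Y \ I).card := by
      rw [← Nat.cast_add, Finset.card_sdiff_of_subset hI',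
        Nat.add_sub_cancel' (Finset.card_le_card hI')]
    have hB : -yGen A + HahnSeries.C (∑ i ∈ Y \ I, x i) =
        HahnSeries.C (∑ i ∈ Y, x i) - (yGen A + HahnSeries.C (∑ i ∈ I, x i)) := by
      rw [← Finset.sum_sdiff hI', map_add]
      ring
    rw [hB] at h2
    rw [hcard]
    simp only [Derivation.leibniz, smul_eq_mul, map_mul, map_add, PowerSeries.derivative_C,
      mul_zero, add_zero, ← Finset.mul_sum] at h1 h2 ⊢
    linear_combination PowerSeries.C (φ (∑ i ∈ I, x i)) * q (Y \ I) * h1 +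
      PowerSeries.C (φ (∑ i ∈ I, x i)) * p I * h2
  · simp

/-- The degree bound for `pairSum`. -/
lemma pdegLE_pairSum {κ A : Type*} [DecidableEq κ] [CommRing A] [IsDomain A] [CharZero A]
    (x : κ → A) (u p q : Finset κ → PowerSeries (LaurentSeries A))
    (hp : LinKdV x (yGen A) u p) (hq : LinKdV x (-yGen A) u q) (hu : ∀ J, PDegLE 0 (u J))
    (hu0 : u ∅ = 0) (hp0 : PowerSeries.coeff 0 (p ∅) = 1) (hq0 : PowerSeries.coeff 0 (q ∅) = 1)
    {d : ℤ} {φ : A → LaurentSeries A} (hφ : HasWeight d φ) (Y Z W : Finset κ) :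
    PDegLE (d + Z.card + W.card) (pairSum x p q φ Y Z W) := by
  induction hn : Y.card using Nat.strong_induction_on generalizing Y Z W d φ with
  | _ n ih =>
    subst hn
    intro g
    induction g using Nat.strong_induction_on generalizing d φ with
    | _ g ihg =>
      have hlin : ∀ {d φ}, HasWeight d φ → HasWeight (d + 1)
          fun c => φ c * (HahnSeries.C (∑ i ∈ Y, x i) - (yGen A + HahnSeries.C c)) := by
        intro d φ hφ
        refine (hφ.mul (((HasWeight.const 0 _ (DegLE.const (∑ i ∈ Y, x i))).mono
          zero_le_one).add ((HasWeight.const 0 _ (DegLE.const (-1))).mul HasWeight.lin))).congr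
          rfl fun c => ?_
        rw [map_neg, map_one]
        ring
      have hrec := congrArg (PowerSeries.coeff g) (eulerOp_pairSum x u p q hp hq φ Y Z W)
      set f := pairSum x p q φ Y Z W with hf
      have hterm : ∀ J ∈ Y.powerset, PDegLE (d + Z.card + W.card) (u J *
          (pairSum x p q (fun c => φ (c + ∑ i ∈ J, x i) *
          (yGen A + HahnSeries.C (c + ∑ i ∈ J, x i))) (Y \ J) (Z \ J) W +
        pairSum x p q (fun c => φ c * (HahnSeries.C (∑ i ∈ Y, x i) - (yGen A + HahnSeries.C c)))
          (Y \ J) Z (W \ J))) := by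
        intro J hJ
        rcases J.eq_empty_or_nonempty with rfl | hne
        · rw [hu0, zero_mul]
          exact PDegLE.zero
        have hlt := Finset.card_lt_card (Finset.sdiff_ssubset (Finset.mem_powerset.1 hJ) hne)
        refine ((hu J).mul ?_).mono (zero_add _).le
        have hφ1 : HasWeight (d + 1) fun c => φ (c + ∑ i ∈ J, x i) *
            (yGen A + HahnSeries.C (c + ∑ i ∈ J, x i)) :=
          (hφ.mul HasWeight.lin).shift (∑ i ∈ J, x i)
        have hcard : ∀ {V : Finset κ}, ¬ Disjoint J V → (V \ J).card + 1 ≤ V.card := by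
          intro V hV
          refine Nat.succ_le_of_lt (Finset.card_lt_card ?_)
          refine Finset.sdiff_subset.ssubset_of_ne fun h => hV ?_
          exact (Finset.sdiff_eq_self_iff_disjoint.1 h).symm
        have hsub : ∀ {V : Finset κ}, ¬ Disjoint J V → ¬ V ⊆ Y \ J := fun hV h =>
          hV (Finset.disjoint_of_subset_right h Finset.disjoint_sdiff)
        by_cases hZ : Disjoint J Z
        · by_cases hW : Disjoint J W
          · rw [Finset.sdiff_eq_self_of_disjoint hZ.symm, Finset.sdiff_eq_self_of_disjoint hW.symm,
              pairSum_add]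
            refine ih _ hlt ?_ _ _ _ rfl
            refine (((hφ.mul HasWeight.lin).diff (∑ i ∈ J, x i)).congr (e := d) (by omega)
              fun _ => rfl).add ((hφ.mul (HasWeight.const 0 _
                (DegLE.const (∑ i ∈ Y, x i)))).congr (add_zero d) fun _ => rfl) |>.congr rfl
              fun c => ?_
            ring
          · rw [pairSum_eq_zero_right x p q _ (hsub hW), zero_add]
            refine (ih _ hlt (hlin hφ) _ _ _ rfl).mono ?_
            have := hcard hW
            omega
        · rw [pairSum_eq_zero_left x p q _ (hsub hZ), add_zero]
          refine (ih _ hlt hφ1 _ _ _ rfl).mono ?_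
          have := hcard hZ
          omega
      have hX : DegLE (d + Z.card + W.card + 2 * g) (PowerSeries.coeff g (PowerSeries.X *
          pairSum x p q (fun c => φ c * ((yGen A + HahnSeries.C c) ^ 3 +
            (HahnSeries.C (∑ i ∈ Y, x i) - (yGen A + HahnSeries.C c)) ^ 3)) Y Z W)) := by
        cases g with
        | zero =>
          rw [PowerSeries.coeff_zero_X_mul]
          exact DegLE.zero
        | succ g =>
          rw [PowerSeries.coeff_succ_X_mul]
          have hw : HasWeight (d + 2) fun c => φ c * ((yGen A + HahnSeries.C c) ^ 3 +
              (HahnSeries.C (∑ i ∈ Y, x i) - (yGen A + HahnSeries.C c)) ^ 3) := by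
            have hS := HasWeight.const 0 _ (DegLE.const (∑ i ∈ Y, x i))
            have hA := HasWeight.lin (A := A)
            have h1 := hS.mul (hA.mul hA)
            have h2 := hS.mul (hA.mul (hlin (HasWeight.const 0 _ (DegLE.const (-1)))))
            have h3 := hS.mul (hlin (hlin (HasWeight.const 0 _ (DegLE.const 1))))
            refine (hφ.mul ((h1.add h2).add h3)).congr (by omega) fun c => ?_
            simp only [map_neg, map_one]
            ring
          refine (ihg g (Nat.lt_succ_self g) hw).mono ?_
          push_cast
          omega
      have hsum : DegLE (d + Z.card + W.card + 2 * g)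
          (((24 * g + 12 * Y.card : ℕ) : LaurentSeries A) * PowerSeries.coeff g f) := by
        have h24 : (24 : PowerSeries (LaurentSeries A)) = PowerSeries.C 12 * 2 := by
          rw [map_ofNat]
          norm_num
        have h12 : (12 : PowerSeries (LaurentSeries A)) = PowerSeries.C ((12 : ℕ) : LaurentSeries A) := by
          rw [map_natCast]
          norm_num
        have hc : (Y.card : PowerSeries (LaurentSeries A)) = PowerSeries.C (Y.card : LaurentSeries A) := by simp
        rw [h24, mul_assoc, map_add, PowerSeries.coeff_C_mul, coeff_two_mul_X_mul_derivative,
          hc, h12, mul_assoc (PowerSeries.C _) (PowerSeries.C _) f, PowerSeries.coeff_C_mul, PowerSeries.coeff_C_mul, map_add,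
          PowerSeries.coeff_C_mul, map_sum] at hrec
        have e : ((24 * g + 12 * Y.card : ℕ) : LaurentSeries A) * PowerSeries.coeff g f =
            12 * (2 * g * PowerSeries.coeff g f) +
            ((12 : ℕ) : LaurentSeries A) * (Y.card * PowerSeries.coeff g f) := by
          push_cast
          ring
        rw [e, hrec]
        refine DegLE.add ?_ hX
        exact ((DegLE.natCast 12).mul (DegLE.sum fun J hJ => hterm J hJ g)).mono
          (zero_add _).le
      by_cases h0 : 24 * g + 12 * Y.card = 0
      · have hg : g = 0 := by omega
        have hY : Y = ∅ := Finset.card_eq_zero.1 (by omega)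
        subst hg hY
        rw [hf, pairSum, Finset.powerset_empty, Finset.sum_singleton]
        split_ifs
        · rw [PowerSeries.coeff_mul, Finset.Nat.antidiagonal_zero, Finset.sum_singleton,
            PowerSeries.coeff_C_mul, Finset.sdiff_empty, hp0, hq0, mul_one, mul_one]
          refine (hφ.degLE _).mono ?_
          push_cast
          omega
        · exact DegLE.zero
      · exact hsum.of_natCast_mul h0

lemma yLau_true (n : ℕ) : yLau n true = yGen (R n) := by
  rw [yLau, if_pos rfl, one_mul, yGen]

lemma yLau_false (n : ℕ) : yLau n false = -yGen (R n) := by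
  rw [yLau, if_neg Bool.false_ne_true, yGen]
  ring

lemma yLau_sq_mul_single (n : ℕ) (σ : Bool) :
    yLau n σ ^ 2 * HahnSeries.single (2 : ℤ) (1 : R n) = 1 := by
  have h : yGen (R n) ^ 2 * HahnSeries.single (2 : ℤ) (1 : R n) = 1 := by
    rw [yGen, sq, HahnSeries.single_mul_single, HahnSeries.single_mul_single]
    norm_num
  cases σ
  · rw [yLau_false]
    linear_combination h
  · rw [yLau_true, h]

lemma binomZ_neg_one (k : ℕ) : binomZ (-1) k = (-1) ^ k := by
  have h : ∏ i ∈ range k, (((-1 : ℤ) : ℚ) - i) = (-1) ^ k * k.factorial := by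
    induction k with
    | zero => simp
    | succ k ih =>
      rw [Finset.prod_range_succ, ih, Nat.factorial_succ]
      push_cast
      ring
  rw [binomZ, h, mul_div_cancel_right₀ _ (Nat.cast_ne_zero.2 k.factorial_ne_zero)]

lemma yGen_add_mul_yExpAdd {n : ℕ} (c : R n) :
    (yGen (R n) + HahnSeries.C c) * yExpAdd c (-1) = 1 := by
  have h1 : (yGen (R n) + HahnSeries.C c) * HahnSeries.single (- -1 : ℤ) (1 : R n) =
      HahnSeries.ofPowerSeries ℤ (R n) (1 + PowerSeries.C c * PowerSeries.X) := by
    rw [map_add (HahnSeries.ofPowerSeries ℤ (R n)), map_one (HahnSeries.ofPowerSeries ℤ (R n)),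
      map_mul (HahnSeries.ofPowerSeries ℤ (R n)), HahnSeries.ofPowerSeries_C,
      HahnSeries.ofPowerSeries_X, add_mul, yGen, HahnSeries.single_mul_single]
    norm_num
  rw [yExpAdd, ← mul_assoc, h1, ← map_mul, ← map_one (HahnSeries.ofPowerSeries ℤ (R n))]
  congr 1
  ext k : 1
  rw [add_mul, one_mul, map_add, mul_assoc, PowerSeries.coeff_C_mul]
  cases k with
  | zero => simp [binomZ_neg_one]
  | succ k =>
    rw [PowerSeries.coeff_succ_X_mul, PowerSeries.coeff_mk, PowerSeries.coeff_mk,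
      binomZ_neg_one, binomZ_neg_one, PowerSeries.coeff_one, if_neg k.succ_ne_zero]
    simp only [map_pow, map_neg, map_one]
    ring

lemma yLau_add_mul_LExp {n : ℕ} (σ : Bool) (c : R n) :
    (yLau n σ + HahnSeries.C c) * LExp σ c (-1) = 1 := by
  cases σ
  · have h := yGen_add_mul_yExpAdd (-c)
    rw [map_neg] at h
    have he : ¬ Even (-1 : ℤ) := by decide
    simp only [yLau_false, LExp, he, if_false, Bool.false_eq_true, neg_mul, one_mul] at h ⊢
    linear_combination h
  · have h := yGen_add_mul_yExpAdd c
    simpa [yLau_true, LExp] using h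

lemma degLE_LExp {n : ℕ} (c : R n) : DegLE (-1) (LExp true c (-1)) := by
  have h : DegLE 0 (HahnSeries.ofPowerSeries ℤ (R n)
      (PowerSeries.mk fun k => MvPolynomial.C (binomZ (-1) k) * c ^ k)) := by
    intro k hk
    rw [HahnSeries.ofPowerSeries_apply, HahnSeries.embDomain_of_notMem_range]
    rintro ⟨m, hm⟩
    have : ((m : ℕ) : ℤ) = k := hm
    omega
  have h1 := (DegLE.single (- -1) (1 : R n)).mul h
  simpa [LExp, yExpAdd] using h1

/-- The values `±y, x_1, …, x_n` at the points labelled by `none, some 1, …, some n`. -/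
def ptVal (n : ℕ) (σ : Bool) : Option (Fin n) → Lau n
  | none => yLau n σ
  | some i => HahnSeries.C (X i)

/-- The set `{none} ∪ Y`. -/
def addPt {n : ℕ} (Y : Finset (Fin n)) : Finset (Option (Fin n)) :=
  insert none (Y.map Function.Embedding.some)

lemma none_notMem_map_some {n : ℕ} (Y : Finset (Fin n)) :
    none ∉ Y.map Function.Embedding.some := by simp

lemma card_addPt {n : ℕ} (Y : Finset (Fin n)) : (addPt Y).card = Y.card + 1 := by
  rw [addPt, Finset.card_insert_of_notMem (none_notMem_map_some Y), Finset.card_map]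

lemma sum_ptVal_addPt {n : ℕ} (σ : Bool) (Y : Finset (Fin n)) :
    ∑ i ∈ addPt Y, ptVal n σ i = yLau n σ + HahnSeries.C (∑ i ∈ Y, X i) := by
  rw [addPt, Finset.sum_insert (none_notMem_map_some Y), Finset.sum_map, map_sum]
  rfl

lemma setConv_kdvSeries_addPt {n : ℕ} (σ : Bool) (Y : Finset (Fin n)) :
    setConv (kdvSeries (ptVal n σ)) (kdvSeries (ptVal n σ)) (addPt Y) =
      2 * ∑ J ∈ Y.powerset, PowerSeries.map HahnSeries.C (kdvSeries (X : Fin n → R n) J) *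
        kdvSeries (ptVal n σ) (addPt (Y \ J)) := by
  rw [addPt, setConv_insert _ (none_notMem_map_some Y), sum_powerset_map]
  refine congrArg (2 * ·) (Finset.sum_congr rfl fun J _ => ?_)
  rw [map_kdvSeries HahnSeries.C Function.Embedding.some X (ptVal n σ) J fun _ _ => rfl, addPt,
    Finset.map_sdiff]

lemma linKdV_kdvSeries {n : ℕ} (σ : Bool) : LinKdV (X : Fin n → R n) (yLau n σ)
    (fun J => PowerSeries.map HahnSeries.C (kdvSeries (X : Fin n → R n) J))
    (fun Y => kdvSeries (ptVal n σ) (addPt Y)) := by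
  intro Y
  have h := kdvSeries_eq (ptVal n σ) (addPt Y)
  simp only [eulerOp, sumMul, setConv_kdvSeries_addPt, sum_ptVal_addPt, card_addPt] at h
  push_cast at h
  simp only [map_pow]
  linear_combination h

lemma finSucc_map_univ {n : ℕ} (T : Finset (Fin n)) :
    (univ : Finset (Fin (T.card + 1))).map ((finSuccEquiv T.card).toEmbedding.trans
      (T.orderEmbOfFin rfl).toEmbedding.optionMap) = addPt T := by
  rw [← Finset.map_map, Finset.map_univ_equiv]
  ext o
  rw [addPt]
  cases o with
  | none => simp
  | some i =>
    have h := Set.ext_iff.1 (Finset.range_orderEmbOfFin T rfl) i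
    rw [Set.mem_range, Finset.mem_coe] at h
    simp [h]

/-- Multiplication by `(±y + x_T)²` turns `F_g(±y, x_T)` into `U_g(±y, x_T)`. -/
lemma sq_mul_FExp {n : ℕ} (σ : Bool) (g : ℕ) (T : Finset (Fin n)) :
    (yLau n σ + HahnSeries.C (∑ i ∈ T, X i)) ^ 2 * FExp σ g T =
      kdvCoeff (ptVal n σ) (addPt T) g := by
  by_cases h0 : g = 0 ∧ T.card = 0
  · obtain ⟨rfl, hT⟩ := h0
    obtain rfl := Finset.card_eq_zero.1 hT
    rw [FExp, if_pos ⟨rfl, hT⟩, Finset.sum_empty, map_zero, add_zero, yLau_sq_mul_single,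
      kdvCoeff_card_one _ (card_addPt ∅)]
  by_cases h1 : g = 0 ∧ T.card = 1
  · obtain ⟨rfl, hT⟩ := h1
    rw [FExp, if_neg h0, if_pos ⟨rfl, hT⟩]
    obtain ⟨i, rfl⟩ := Finset.card_eq_one.1 hT
    have h := kdvCoeff_eq (ptVal n σ) (addPt {i}) 0
    have hc : PowerSeries.coeff 0 (setConv (kdvSeries (ptVal n σ)) (kdvSeries (ptVal n σ))
        (addPt {i})) = 2 := by
      have hi : ({i} : Finset (Fin n)).powerset = {∅, {i}} := by
        ext J
        simp [Finset.subset_singleton_iff]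
      have h2 : (2 : PowerSeries (Lau n)) = PowerSeries.C 2 := (map_ofNat PowerSeries.C 2).symm
      rw [setConv_kdvSeries_addPt, h2, PowerSeries.coeff_C_mul,
        hi, Finset.sum_pair (Finset.singleton_ne_empty i).symm,
        kdvSeries_empty, Finset.sdiff_self]
      simp [kdvSeries, PowerSeries.coeff_mul, kdvCoeff_card_one, card_addPt]
    rw [hc, sum_ptVal_addPt, card_addPt, PowerSeries.coeff_zero_X_mul] at h
    simp only [Finset.card_singleton] at h
    push_cast at h
    have h12 : IsUnit (12 : Lau n) := by
      simpa [map_ofNat] using (IsUnit.mk0 (12 : ℚ) (by norm_num)).map (algebraMap ℚ (Lau n))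
    refine h12.mul_left_cancel ?_
    have hi := yLau_add_mul_LExp σ (∑ j ∈ ({i} : Finset (Fin n)), X j : R n)
    linear_combination 12 * (yLau n σ + HahnSeries.C (∑ j ∈ ({i} : Finset (Fin n)), X j)) * hi - h
  · rw [FExp, if_neg h0, if_neg h1]
    set θ := MvPolynomial.eval₂Hom ((HahnSeries.C).comp (algebraMap ℚ (R n)))
      (Fin.cons (yLau n σ)
        (fun i : Fin T.card => HahnSeries.C (X ((T.orderIsoOfFin rfl) i : Fin n)))) with hθ
    have hX : ∀ j : Fin (T.card + 1), ptVal n σ (((finSuccEquiv T.card).toEmbedding.trans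
      (T.orderEmbOfFin rfl).toEmbedding.optionMap) j) = θ (X j) := by
      intro j
      rw [hθ, MvPolynomial.eval₂Hom_X']
      refine Fin.cases ?_ (fun i => ?_) j
      · simp [ptVal]
      · simp [ptVal]
    have hF := congrArg θ (sum_sq_mul_polyOf_Fnpt (T.card + 1) g (Nat.succ_pos _) (by omega))
    rw [map_kdvCoeff θ _ X (ptVal n σ) univ (fun j _ => hX j), finSucc_map_univ, map_mul,
      map_pow, map_sum, ← Finset.sum_congr rfl fun j _ => hX j,
      ← Finset.sum_map univ _ (ptVal n σ), finSucc_map_univ, sum_ptVal_addPt] at hF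
    exact hF

lemma FExp_true_eq {n : ℕ} (g : ℕ) (T : Finset (Fin n)) :
    FExp true g T = LExp true (∑ i ∈ T, X i) (-1) ^ 2 * kdvCoeff (ptVal n true) (addPt T) g := by
  have h := yLau_add_mul_LExp true (∑ i ∈ T, X i : R n)
  rw [← sq_mul_FExp, ← mul_assoc, ← mul_pow, mul_comm (LExp _ _ _), h, one_pow, one_mul]

lemma FExp_false_eq {n : ℕ} (g : ℕ) (T : Finset (Fin n)) :
    FExp false g T =
      LExp true (-∑ i ∈ T, X i) (-1) ^ 2 * kdvCoeff (ptVal n false) (addPt T) g := by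
  have h := yLau_add_mul_LExp true (-∑ i ∈ T, X i : R n)
  have h2 : (yLau n false + HahnSeries.C (∑ i ∈ T, X i)) ^ 2 =
      (yLau n true + HahnSeries.C (-∑ i ∈ T, X i)) ^ 2 := by
    rw [yLau_true, yLau_false, map_neg]
    ring
  rw [← sq_mul_FExp, h2, ← mul_assoc, ← mul_pow, mul_comm (LExp _ _ _), h, one_pow, one_mul]

section Indices

variable {a b n : ℕ}

lemma zIdx_or_wIdx_or_xIdx (v : Fin (a + b + n)) :
    (∃ i, zIdx a b n i = v) ∨ (∃ i, wIdx a b n i = v) ∨ ∃ i, xIdx a b n i = v := by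
  have hv := v.2
  by_cases h1 : v.1 < a
  · exact Or.inl ⟨⟨v.1, h1⟩, rfl⟩
  by_cases h2 : v.1 < a + b
  · refine Or.inr (Or.inl ⟨⟨v.1 - a, by omega⟩, Fin.ext ?_⟩)
    simp only [wIdx]
    omega
  · refine Or.inr (Or.inr ⟨⟨v.1 - (a + b), by omega⟩, Fin.ext ?_⟩)
    simp only [xIdx]
    omega

lemma xIdx_injective : Function.Injective (xIdx a b n) := fun i j h => by
  simpa [xIdx, Fin.ext_iff] using h

lemma zIdx_ne_wIdx (i : Fin a) (j : Fin b) : zIdx a b n i ≠ wIdx a b n j := by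
  simp only [zIdx, wIdx, ne_eq, Fin.ext_iff]
  omega

lemma zIdx_ne_xIdx (i : Fin a) (j : Fin n) : zIdx a b n i ≠ xIdx a b n j := by
  simp only [zIdx, xIdx, ne_eq, Fin.ext_iff]
  omega

lemma wIdx_ne_xIdx (i : Fin b) (j : Fin n) : wIdx a b n i ≠ xIdx a b n j := by
  simp only [wIdx, xIdx, ne_eq, Fin.ext_iff]
  omega

lemma univ_sdiff_zIdx_union (I : Finset (Fin n)) :
    univ \ (univ.image (zIdx a b n) ∪ I.image (xIdx a b n)) =
      univ.image (wIdx a b n) ∪ Iᶜ.image (xIdx a b n) := by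
  ext v
  rcases zIdx_or_wIdx_or_xIdx v with ⟨i, rfl⟩ | ⟨i, rfl⟩ | ⟨i, rfl⟩ <;>
    simp [xIdx_injective.eq_iff, zIdx_ne_wIdx, zIdx_ne_xIdx, wIdx_ne_xIdx,
      (zIdx_ne_wIdx _ _).symm, (zIdx_ne_xIdx _ _).symm, (wIdx_ne_xIdx _ _).symm]

/-- Distributing the `x_i` over two factors containing the `z_i` and the `w_i`, respectively. -/
lemma sum_zIdx_wIdx {M : Type*} [AddCommMonoid M]
    (F : Finset (Fin (a + b + n)) → Finset (Fin (a + b + n)) → M) :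
    ∑ I : Finset (Fin n), F (univ.image (zIdx a b n) ∪ I.image (xIdx a b n))
        (univ.image (wIdx a b n) ∪ Iᶜ.image (xIdx a b n)) =
      ∑ T ∈ (univ : Finset (Fin (a + b + n))).powerset,
        if univ.image (zIdx a b n) ⊆ T ∧ univ.image (wIdx a b n) ⊆ univ \ T then
          F T (univ \ T) else 0 := by
  rw [← Finset.sum_filter]
  refine Finset.sum_bij' (fun I _ => univ.image (zIdx a b n) ∪ I.image (xIdx a b n))
    (fun T _ => univ.filter fun i => xIdx a b n i ∈ T) ?_ ?_ ?_ ?_ ?_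
  · intro I _
    simp only [Finset.mem_filter, Finset.powerset_univ, Finset.mem_univ, true_and,
      univ_sdiff_zIdx_union]
    exact ⟨Finset.subset_union_left, Finset.subset_union_left⟩
  · intro T _
    exact Finset.mem_univ _
  · intro I _
    ext i
    simp [xIdx_injective.eq_iff, zIdx_ne_xIdx]
  · intro T hT
    obtain ⟨hZ, hW⟩ := (Finset.mem_filter.1 hT).2
    ext v
    rcases zIdx_or_wIdx_or_xIdx v with ⟨i, rfl⟩ | ⟨i, rfl⟩ | ⟨i, rfl⟩
    · have := hZ (Finset.mem_image_of_mem _ (Finset.mem_univ i))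
      simp [this]
    · have := (Finset.mem_sdiff.1 (hW (Finset.mem_image_of_mem _ (Finset.mem_univ i)))).2
      simp [this, zIdx_ne_wIdx, (wIdx_ne_xIdx _ _).symm]
    · simp [xIdx_injective.eq_iff, zIdx_ne_xIdx]
  · intro I _
    rw [univ_sdiff_zIdx_union]

end Indices

/-- `L_g(y; z; w; x)` is a coefficient of a `pairSum`. -/
lemma LLm_eq_coeff_pairSum (g n a b : ℕ) :
    LLm g n a b = PowerSeries.coeff g (pairSum (X : Fin (a + b + n) → R (a + b + n))
      (fun Y => kdvSeries (ptVal _ true) (addPt Y)) (fun Y => kdvSeries (ptVal _ false) (addPt Y))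
      (fun c => LExp true c (-1) ^ 2 * LExp true (c + -∑ i, X i) (-1) ^ 2) univ
      (univ.image (zIdx a b n)) (univ.image (wIdx a b n))) := by
  rw [LLm, Finset.sum_comm, sum_zIdx_wIdx fun T T' => ∑ gp ∈ range (g + 1),
    FExp true gp T * FExp false (g - gp) T', pairSum, map_sum]
  refine Finset.sum_congr rfl fun T _ => ?_
  split_ifs
  · rw [mul_assoc, PowerSeries.coeff_C_mul, PowerSeries.coeff_mul,
      Finset.Nat.sum_antidiagonal_eq_sum_range_succ_mk, Finset.mul_sum]
    refine Finset.sum_congr rfl fun gp _ => ?_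
    have hT : ∑ i ∈ T, X i + -∑ i, X i = -∑ i ∈ univ \ T, (X i : R (a + b + n)) := by
      rw [← Finset.sum_sdiff (Finset.subset_univ T)]
      ring
    rw [hT, FExp_true_eq, FExp_false_eq, kdvSeries, kdvSeries, PowerSeries.coeff_mk,
      PowerSeries.coeff_mk]
    ring
  · rw [map_zero]

lemma degLE_LLm (g n a b : ℕ) : DegLE (-4 + a + b + 2 * g) (LLm g n a b) := by
  have hinv : HasWeight (-1) fun c : R (a + b + n) => LExp true c (-1) :=
    HasWeight.inv _ (fun c => by simpa only [yLau_true] using yLau_add_mul_LExp true c) degLE_LExp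
  have hinv' := hinv.shift (-∑ i, X i)
  have hφ : HasWeight (-4) fun c : R (a + b + n) =>
      LExp true c (-1) ^ 2 * LExp true (c + -∑ i, X i) (-1) ^ 2 :=
    ((hinv.mul hinv).mul (hinv'.mul hinv')).congr (by norm_num) fun c => by ring
  have hp := linKdV_kdvSeries (n := a + b + n) true
  have hq := linKdV_kdvSeries (n := a + b + n) false
  rw [yLau_true] at hp
  rw [yLau_false] at hq
  have h := pdegLE_pairSum _ _ _ _ hp hq (fun J g => ?_) ?_ ?_ ?_ hφ univ
    (univ.image (zIdx a b n)) (univ.image (wIdx a b n)) g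
  · rw [← LLm_eq_coeff_pairSum] at h
    refine h.mono ?_
    have h1 := Finset.card_image_le (s := univ) (f := zIdx a b n)
    have h2 := Finset.card_image_le (s := univ) (f := wIdx a b n)
    simp only [Finset.card_univ, Fintype.card_fin] at h1 h2
    omega
  · rw [PowerSeries.coeff_map]
    exact (DegLE.const _).mono (by omega)
  · rw [kdvSeries_empty, map_zero]
  · rw [kdvSeries, PowerSeries.coeff_mk, kdvCoeff_card_one _ (card_addPt ∅)]
  · rw [kdvSeries, PowerSeries.coeff_mk, kdvCoeff_card_one _ (card_addPt ∅)]

/-- For `g ≥ 0`, `n ≥ 1`, `a, b ≥ 0` and every integer `k ≥ 2g−3+a+b`, the coefficient of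
`y^k` times any monomial in `z, w, x` in `L_g(y; z; w; x)` vanishes. -/
theorem Lmulti_high_coeff_vanish (g n a b : ℕ) (hn : 1 ≤ n) (k : ℤ)
    (hk : 2*(g : ℤ) - 3 + a + b ≤ k) (e : Fin (a+b+n) → ℕ) :
    coeffL (LLm g n a b) k e = 0 := by
  rw [coeffL, degLE_LLm g n a b (-k) (by omega), MvPolynomial.coeff_zero]

end
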